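/- arXiv:2504.04496 — 2 statements merged into one kernel-verified Lean document; each statement's English description precedes it below -/
import Mathlib

section
/- Every (fork, odd parachute)-free graph G satisfies χ(G) ≤ ω(G)(ω(G)+1)/2. -/
open SimpleGraph

/-- The clique number ω(G). -/
noncomputable def cliqueNumber {V : Type*} (G : SimpleGraph V) : ℕ :=
  sSup {n | ∃ s : Finset V, G.IsNClique n s}

/-- A graph is perfect if every induced subgraph has chromatic number equal to clique number. -/
def IsPerfectGraph {V : Type*} (G : SimpleGraph V) : Prop :=
  ∀ S : Set V, (G.induce S).chromaticNumber = (cliqueNumber (G.induce S) : ℕ∞)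

/-- A graph is perfectly divisible if each (nonempty) induced subgraph H has a partition of its
vertices into A and B with H[A] perfect and ω(H[B]) < ω(H). -/
def PerfectlyDivisible {V : Type*} (G : SimpleGraph V) : Prop :=
  ∀ S : Set V, S.Nonempty →
    ∃ A B : Set V, A ∪ B = S ∧ A ∩ B = ∅ ∧
      IsPerfectGraph (G.induce A) ∧
      cliqueNumber (G.induce B) < cliqueNumber (G.induce S)

/-- A vertex is trisimplicial if its neighborhood is the union of three cliques. -/
def Trisimplicial {V : Type*} (G : SimpleGraph V) (u : V) : Prop :=
  ∃ C₁ C₂ C₃ : Set V, G.IsClique C₁ ∧ G.IsClique C₂ ∧ G.IsClique C₃ ∧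
    G.neighborSet u = C₁ ∪ C₂ ∪ C₃

/-- The claw K₁,₃ : vertex 0 is the center, adjacent to 1, 2, 3. -/
def claw : SimpleGraph (Fin 4) :=
  SimpleGraph.fromRel (fun a _ => a = 0)

/-- The fork (chair): claw with one edge subdivided once.
Vertex 2 is the center, adjacent to 0, 1, 3; and 3 is adjacent to 4. -/
def fork : SimpleGraph (Fin 5) :=
  SimpleGraph.fromRel (fun a b => (a = 2 ∧ (b = 0 ∨ b = 1 ∨ b = 3)) ∨ (a = 3 ∧ b = 4))

/-- The odd parachute on hole length n: hole vertices `Sum.inl i` (i : ZMod n),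
`Sum.inr 0` is complete to the hole, `Sum.inr 1` is adjacent only to `Sum.inr 0`. -/
def oddParachute (n : ℕ) : SimpleGraph (ZMod n ⊕ Fin 2) :=
  SimpleGraph.fromRel (fun a b =>
    (∃ i : ZMod n, a = Sum.inl i ∧ b = Sum.inl (i + 1)) ∨
    (∃ i : ZMod n, a = Sum.inl i ∧ b = Sum.inr 0) ∨
    (a = Sum.inr 0 ∧ b = Sum.inr 1))

/-- The odd balloon on hole length n: hole vertices `Sum.inl i`, the center `Sum.inr 0`
adjacent to the consecutive hole vertices `Sum.inl 0`, `Sum.inl 1` and to the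
pendant vertex `Sum.inr 1`. -/
def oddBalloon (n : ℕ) : SimpleGraph (ZMod n ⊕ Fin 2) :=
  SimpleGraph.fromRel (fun a b =>
    (∃ i : ZMod n, a = Sum.inl i ∧ b = Sum.inl (i + 1)) ∨
    (a = Sum.inr 0 ∧ (b = Sum.inl 0 ∨ b = Sum.inl 1 ∨ b = Sum.inr 1)))

/-- G has no induced fork. -/
def ForkFree {V : Type*} (G : SimpleGraph V) : Prop := IsEmpty (fork ↪g G)

/-- G has no induced claw. -/
def ClawFree {V : Type*} (G : SimpleGraph V) : Prop := IsEmpty (claw ↪g G)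

/-- G has no induced odd parachute. -/
def OddParachuteFree {V : Type*} (G : SimpleGraph V) : Prop :=
  ∀ n : ℕ, 5 ≤ n → Odd n → IsEmpty (oddParachute n ↪g G)

/-- `v : ZMod n → V` enumerates an induced cycle of `G`:
`v` is injective and `v i ~ v j` iff `i, j` are consecutive mod `n`. -/
def IsInducedCycle {V : Type*} (G : SimpleGraph V) {n : ℕ} (v : ZMod n → V) : Prop :=
  Function.Injective v ∧ ∀ i j : ZMod n, G.Adj (v i) (v j) ↔ (j = i + 1 ∨ i = j + 1)

section Colour

variable {V : Type*} {G : SimpleGraph V}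

/-- `S` can be properly coloured with `n` colours. -/
def ColourableOn (G : SimpleGraph V) (S : Set V) (n : ℕ) : Prop :=
  ∃ c : V → ℕ, (∀ x ∈ S, c x < n) ∧ ∀ x ∈ S, ∀ y ∈ S, G.Adj x y → c x ≠ c y

/-- Every clique inside `S` has at most `m` vertices. -/
def CliqueBoundOn (G : SimpleGraph V) (S : Set V) (m : ℕ) : Prop :=
  ∀ K : Finset V, (K : Set V) ⊆ S → G.IsClique K → K.card ≤ m

theorem ColourableOn.mono {S T : Set V} {m n : ℕ} (h : ColourableOn G T m) (hS : S ⊆ T)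
    (hmn : m ≤ n) : ColourableOn G S n := by
  obtain ⟨c, h1, h2⟩ := h
  exact ⟨c, fun x hx => (h1 x (hS hx)).trans_le hmn, fun x hx y hy => h2 x (hS hx) y (hS hy)⟩

theorem CliqueBoundOn.mono {S T : Set V} {m n : ℕ} (h : CliqueBoundOn G T m) (hS : S ⊆ T)
    (hmn : m ≤ n) : CliqueBoundOn G S n :=
  fun K hK hc => (h K (hK.trans hS) hc).trans hmn

open Classical in
theorem ColourableOn.union_add {S T : Set V} {m n : ℕ} (hS : ColourableOn G S m)
    (hT : ColourableOn G T n) : ColourableOn G (S ∪ T) (m + n) := by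
  obtain ⟨c, h1, h2⟩ := hS
  obtain ⟨d, h3, h4⟩ := hT
  refine ⟨fun x => if x ∈ S then c x else m + d x, ?_, ?_⟩
  · intro x hx
    simp only []
    split_ifs with h
    · exact (h1 x h).trans_le (by omega)
    · have := h3 x (hx.resolve_left h)
      omega
  · rintro x hx y hy hxy
    simp only []
    split_ifs with h h' h'
    · exact h2 x h y h' hxy
    · have := h1 x h
      omega
    · have := h1 y h'
      omega
    · have := h4 x (hx.resolve_left h) y (hy.resolve_left h') hxy
      omega

open Classical in
theorem ColourableOn.union_of_not_adj {S T : Set V} {n : ℕ} (hS : ColourableOn G S n)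
    (hT : ColourableOn G T n) (hST : ∀ x ∈ S, ∀ y ∈ T, ¬ G.Adj x y) :
    ColourableOn G (S ∪ T) n := by
  obtain ⟨c, h1, h2⟩ := hS
  obtain ⟨d, h3, h4⟩ := hT
  refine ⟨fun x => if x ∈ S then c x else d x, ?_, ?_⟩
  · rintro x hx
    simp only []
    split_ifs with h
    · exact h1 x h
    · exact h3 x (hx.resolve_left h)
  · rintro x hx y hy hxy
    simp only []
    split_ifs with h h' h'
    · exact h2 x h y h' hxy
    · exact absurd hxy (hST x h y (hy.resolve_left h'))
    · exact absurd hxy.symm (hST y h' x (hx.resolve_left h))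
    · exact h4 x (hx.resolve_left h) y (hy.resolve_left h') hxy

theorem colourableOn_singleton (v : V) : ColourableOn G {v} 1 := by
  refine ⟨fun _ => 0, by simp, ?_⟩
  rintro x rfl y rfl h
  exact absurd rfl h.ne

open Classical in
/-- A partial colouring extends to a vertex with few neighbours. -/
theorem ColourableOn.insert_of_card_lt [Fintype V] {S : Set V} {n : ℕ} {r : V}
    (hS : ColourableOn G S n)
    (hr : (Finset.univ.filter fun x => x ∈ S ∧ G.Adj r x).card < n) :
    ColourableOn G (insert r S) n := by
  obtain ⟨c, h1, h2⟩ := hS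
  by_cases hrS : r ∈ S
  · rw [Set.insert_eq_of_mem hrS]
    exact ⟨c, h1, h2⟩
  obtain ⟨k, hk, hk'⟩ : ∃ k ∈ Finset.range n,
      k ∉ (Finset.univ.filter fun x => x ∈ S ∧ G.Adj r x).image c := by
    apply Finset.exists_mem_notMem_of_card_lt_card
    rw [Finset.card_range]
    exact Finset.card_image_le.trans_lt hr
  have hk2 : ∀ x ∈ S, G.Adj r x → c x ≠ k := by
    intro x hx hrx he
    exact hk' (Finset.mem_image.2 ⟨x, by simp [hx, hrx], he⟩)
  have hne : ∀ x ∈ S, x ≠ r := fun x hx h => hrS (h ▸ hx)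
  refine ⟨Function.update c r k, ?_, ?_⟩
  · rintro x (rfl | hx)
    · simpa using hk
    · rw [Function.update_of_ne (hne x hx)]
      exact h1 x hx
  · rintro x (rfl | hx) y (rfl | hy) hxy
    · exact absurd rfl hxy.ne
    · rw [Function.update_self, Function.update_of_ne (hne y hy)]
      exact (hk2 y hy hxy).symm
    · rw [Function.update_self, Function.update_of_ne (hne x hx)]
      exact hk2 x hx hxy.symm
    · rw [Function.update_of_ne (hne x hx), Function.update_of_ne (hne y hy)]
      exact h2 x hx y hy hxy

open Classical in
/-- If `A` is matched into `B` by non-edges, then `A ∪ B` needs at most `|B|` colours. -/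
theorem colourableOn_union_of_injOn (A B : Finset V) (g : V → V) (hg : Set.InjOn g A)
    (hgB : ∀ a ∈ A, g a ∈ B) (hgadj : ∀ a ∈ A, ¬ G.Adj a (g a)) :
    ColourableOn G (A ∪ B : Finset V) B.card := by
  obtain ⟨e, he⟩ : ∃ e : V → ℕ, (∀ b ∈ B, e b < B.card) ∧ Set.InjOn e B := by
    refine ⟨fun b => if h : b ∈ B then B.equivFin ⟨b, h⟩ else 0, ?_, ?_⟩
    · intro b hb
      simp [hb]
    · intro b hb b' hb' h
      have hb1 : b ∈ B := hb
      have hb2 : b' ∈ B := hb'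
      simpa [hb1, hb2, Fin.val_inj] using h
  refine ⟨fun x => if x ∈ B then e x else e (g x), ?_, ?_⟩
  · intro x hx
    have hx' : x ∈ A ∨ x ∈ B := by simpa using hx
    simp only []
    split_ifs with h
    · exact he.1 x h
    · exact he.1 _ (hgB x (hx'.resolve_right h))
  · intro x hx y hy hxy
    have hx' : x ∈ A ∨ x ∈ B := by simpa using hx
    have hy' : y ∈ A ∨ y ∈ B := by simpa using hy
    simp only []
    split_ifs with h h' h' <;> intro heq
    · exact hxy.ne (he.2 h h' heq)
    · have hyA := hy'.resolve_right h'
      have := he.2 h (hgB y hyA) heq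
      exact hgadj y hyA (this ▸ hxy.symm)
    · have hxA := hx'.resolve_right h
      have := he.2 (hgB x hxA) h' heq
      exact hgadj x hxA (this ▸ hxy)
    · have hxA := hx'.resolve_right h
      have hyA := hy'.resolve_right h'
      exact hxy.ne (hg hxA hyA (he.2 (hgB x hxA) (hgB y hyA) heq))

theorem colourableOn_card (K : Finset V) : ColourableOn G K K.card := by
  classical
  simpa using colourableOn_union_of_injOn (G := G) ∅ K id (by simp) (by simp) (by simp)

open Classical in
/-- The vertices of `B` with a non-neighbour in `T`. -/
noncomputable def nonNbrs (G : SimpleGraph V) (B T : Finset V) : Finset V :=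
  B.filter fun b => ∃ a ∈ T, ¬ G.Adj a b

open Classical in
theorem exists_injOn_of_card_le_nonNbrs (A B : Finset V)
    (h : ∀ T ⊆ A, T.card ≤ (nonNbrs G B T).card) :
    ∃ g : V → V, Set.InjOn g A ∧ (∀ a ∈ A, g a ∈ B) ∧ ∀ a ∈ A, ¬ G.Adj a (g a) := by
  obtain ⟨f, hf, hf'⟩ := (Finset.all_card_le_biUnion_card_iff_exists_injective
    (fun a : A => B.filter fun b => ¬ G.Adj a b)).1 (by
      intro s
      have := h (s.map (Function.Embedding.subtype _)) (by
        intro x hx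
        simp only [Finset.mem_map, Function.Embedding.subtype_apply] at hx
        obtain ⟨y, -, rfl⟩ := hx
        exact y.2)
      rw [Finset.card_map] at this
      refine this.trans (Finset.card_le_card ?_)
      intro b hb
      simp only [nonNbrs, Finset.mem_filter, Finset.mem_map,
        Function.Embedding.subtype_apply] at hb
      obtain ⟨hbB, a, ⟨y, hy, rfl⟩, hab⟩ := hb
      exact Finset.mem_biUnion.2 ⟨y, hy, by simp [hbB, hab]⟩)
  refine ⟨fun x => if hx : x ∈ A then f ⟨x, hx⟩ else x, ?_, ?_, ?_⟩
  · intro x hx y hy hxy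
    have hx' : x ∈ A := hx
    have hy' : y ∈ A := hy
    simp only [hx', hy', dif_pos] at hxy
    simpa using hf hxy
  · intro a ha
    have := hf' ⟨a, ha⟩
    simp only [Finset.mem_filter] at this
    simpa [ha] using this.1
  · intro a ha
    have := hf' ⟨a, ha⟩
    simp only [Finset.mem_filter] at this
    simpa [ha] using this.2

open Classical in
/-- Complements of bipartite graphs are perfect. -/
theorem colourableOn_union_of_isClique (A B : Finset V) (hA : G.IsClique A) (hB : G.IsClique B)
    (hAB : Disjoint A B) (m : ℕ) (hm : CliqueBoundOn G (A ∪ B : Finset V) m) :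
    ColourableOn G (A ∪ B : Finset V) m := by
  induction A using Finset.strongInduction generalizing B m with
  | H A ih =>
  by_cases hH : ∀ T ⊆ A, T.card ≤ (nonNbrs G B T).card
  · obtain ⟨g, h1, h2, h3⟩ := exists_injOn_of_card_le_nonNbrs A B hH
    exact (colourableOn_union_of_injOn A B g h1 h2 h3).mono le_rfl
      (hm B (by simp) hB)
  push Not at hH
  obtain ⟨T, ⟨hTA, hT⟩, hmin⟩ : ∃ T : Finset V, (T ⊆ A ∧ (nonNbrs G B T).card < T.card) ∧
      ∀ T' ⊂ T, T' ⊆ A → T'.card ≤ (nonNbrs G B T').card := by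
    obtain ⟨T, hT⟩ := hH
    obtain ⟨T, hT, hTm⟩ := wellFounded_lt.has_min
      {T : Finset V | T ⊆ A ∧ (nonNbrs G B T).card < T.card} ⟨T, hT⟩
    refine ⟨T, hT, fun T' hT' hA' => ?_⟩
    by_contra hcon
    exact hTm T' ⟨hA', not_le.1 hcon⟩ hT'
  have hTne : T.Nonempty := Finset.card_pos.1 (by omega)
  obtain ⟨t, ht⟩ := hTne
  set W := nonNbrs G B T with hW
  have hWB : W ⊆ B := Finset.filter_subset _ _
  have hadj : ∀ a ∈ T, ∀ b ∈ B \ W, G.Adj a b := by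
    intro a ha b hb
    rw [Finset.mem_sdiff] at hb
    by_contra hcon
    exact hb.2 (by simp only [hW, nonNbrs, Finset.mem_filter]; exact ⟨hb.1, a, ha, hcon⟩)
  have hcol1 : ColourableOn G (T.erase t ∪ W : Finset V) W.card := by
    obtain ⟨g, h1, h2, h3⟩ := exists_injOn_of_card_le_nonNbrs (G := G) (T.erase t) W (by
      intro T' hT'
      have h4 : T' ⊂ T := lt_of_le_of_lt hT' (Finset.erase_ssubset ht)
      refine (hmin T' h4 (h4.subset.trans hTA)).trans (Finset.card_le_card ?_)
      intro b hb
      simp only [nonNbrs, hW, Finset.mem_filter] at hb ⊢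
      obtain ⟨hb, a, ha, hab⟩ := hb
      exact ⟨⟨hb, a, h4.subset ha, hab⟩, a, ha, hab⟩)
    exact colourableOn_union_of_injOn _ _ g h1 h2 h3
  have hcol2 : ColourableOn G ((A \ T) ∪ (B \ W) : Finset V) (m - T.card) := by
    apply ih (A \ T)
    · exact Finset.sdiff_ssubset hTA ⟨t, ht⟩
    · exact hA.subset (by simp)
    · exact hB.subset (by simp)
    · exact hAB.mono Finset.sdiff_subset Finset.sdiff_subset
    · intro K hK hKc
      have hKm : ∀ x ∈ K, (x ∈ A ∧ x ∉ T) ∨ (x ∈ B ∧ x ∉ W) := by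
        intro x hx
        simpa using hK hx
      have hdis : Disjoint K T := by
        rw [Finset.disjoint_left]
        intro x hx hxT
        rcases hKm x hx with h | h
        · exact h.2 hxT
        · exact Finset.disjoint_left.1 hAB (hTA hxT) h.1
      have := hm (K ∪ T) (by
        intro x hx
        simp only [Finset.coe_union, Set.mem_union, Finset.mem_coe] at hx ⊢
        rcases hx with h | h
        · rcases hKm x h with h | h
          · exact Or.inl h.1
          · exact Or.inr h.1
        · exact Or.inl (hTA h)) (by
        have key : ∀ x ∈ K, ∀ y ∈ T, G.Adj x y := by
          intro x hx y hy
          rcases hKm x hx with h | h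
          · exact hA (Finset.mem_coe.2 h.1) (hTA hy) (fun e => h.2 (e ▸ hy))
          · exact (hadj y hy x (Finset.mem_sdiff.2 h)).symm
        intro x hx y hy hxy
        simp only [Finset.coe_union, Set.mem_union, Finset.mem_coe] at hx hy
        rcases hx with hx | hx <;> rcases hy with hy | hy
        · exact hKc hx hy hxy
        · exact key x hx y hy
        · exact (key y hy x hx).symm
        · exact hA (hTA hx) (hTA hy) hxy)
      rw [Finset.card_union_of_disjoint hdis] at this
      omega
  have hTm : T.card ≤ m := hm T (by
    intro x hx
    simpa using Or.inl (hTA hx)) (hA.subset (by simpa using hTA))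
  refine ((hcol1.union_add (colourableOn_singleton t)).union_add hcol2).mono ?_
    (by omega : W.card + 1 + (m - T.card) ≤ m)
  intro x hx
  simp only [Finset.coe_union, Set.mem_union, Finset.mem_coe, Finset.mem_sdiff,
    Finset.mem_erase, Set.mem_singleton_iff] at hx ⊢
  tauto

end Colour

section Minimal

variable {V : Type*} [Fintype V] {G : SimpleGraph V} {F : Set V}

/-- `F` is an inclusion-minimal set inducing a subgraph whose chromatic number exceeds its clique
number. -/
structure IsMinimallyImperfect (G : SimpleGraph V) (F : Set V) : Prop where
  exists_not_colourableOn : ∃ m, CliqueBoundOn G F m ∧ ¬ ColourableOn G F m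
  colourableOn_of_ssubset : ∀ S ⊂ F, ∀ m, CliqueBoundOn G S m → ColourableOn G S m

open Classical in
theorem exists_isMinimallyImperfect_subset {S : Set V} {m : ℕ} (hS : CliqueBoundOn G S m)
    (hn : ¬ ColourableOn G S m) : ∃ F ⊆ S, IsMinimallyImperfect G F := by
  obtain ⟨F, ⟨hF, hF'⟩, hmin⟩ := wellFounded_lt.has_min
    {F : Set V | F ⊆ S ∧ ∃ m, CliqueBoundOn G F m ∧ ¬ ColourableOn G F m} ⟨S, le_rfl, m, hS, hn⟩
  refine ⟨F, hF, hF', fun T hT k hk => ?_⟩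
  by_contra hcon
  exact hmin T ⟨hT.subset.trans hF, k, hk, hcon⟩ hT

open Classical in
theorem exists_max_clique (G : SimpleGraph V) (T : Set V) :
    ∃ K : Finset V, (K : Set V) ⊆ T ∧ G.IsClique K ∧ CliqueBoundOn G T K.card := by
  obtain ⟨K, hK, hmax⟩ := Finset.exists_max_image
    (Finset.univ.filter fun K : Finset V => (K : Set V) ⊆ T ∧ G.IsClique K) Finset.card
    ⟨∅, by simp⟩
  simp only [Finset.mem_filter, Finset.mem_univ, true_and] at hK hmax
  exact ⟨K, hK.1, hK.2, fun L hL hLc => hmax L ⟨hL, hLc⟩⟩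

namespace IsMinimallyImperfect

open Classical in
/-- Homogeneous proper subsets of a minimally imperfect set are cliques. -/
theorem isClique_of_homogeneous (hF : IsMinimallyImperfect G F) {T : Set V} (hTF : T ⊆ F)
    (hne : T ≠ F)
    (hom : ∀ z ∈ F, z ∉ T → (∀ x ∈ T, G.Adj z x) ∨ (∀ x ∈ T, ¬ G.Adj z x)) : G.IsClique T := by
  by_contra hT
  obtain ⟨m, hm, hnot⟩ := hF.exists_not_colourableOn
  obtain ⟨K, hKT, hK, hKmax⟩ := exists_max_clique G T
  obtain ⟨cT, hcT, hcT'⟩ := hF.colourableOn_of_ssubset T (lt_of_le_of_ne hTF hne) _ hKmax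
  have hS : (F \ T) ∪ (K : Set V) ⊂ F := by
    refine lt_of_le_of_ne (Set.union_subset Set.sdiff_subset (hKT.trans hTF)) fun he => ?_
    refine hT (hK.subset fun x hx => ?_)
    have := hTF hx
    rw [← he] at this
    exact this.resolve_left fun h => h.2 hx
  obtain ⟨c, hc, hc'⟩ := hF.colourableOn_of_ssubset _ hS m (hm.mono hS.subset le_rfl)
  obtain ⟨e, he, hinj⟩ : ∃ e : ℕ → V, (∀ i < K.card, e i ∈ K) ∧
      ∀ i < K.card, ∀ j < K.card, e i = e j → i = j := by
    by_cases hK0 : K.card = 0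
    · by_cases hV : Nonempty V
      · exact ⟨fun _ => hV.some, by omega, by omega⟩
      · exfalso
        exact hT fun x _ => absurd ⟨x⟩ hV
    · obtain ⟨v, -⟩ := Finset.card_pos.1 (Nat.pos_of_ne_zero hK0)
      refine ⟨fun i => if h : i < K.card then K.equivFin.symm ⟨i, h⟩ else v, ?_, ?_⟩
      · intro i hi
        simp [hi]
      · intro i hi j hj hij
        simp only [hi, hj, dif_pos] at hij
        simpa using K.equivFin.symm.injective (Subtype.ext hij)
  refine hnot ⟨fun x => if x ∈ T then c (e (cT x)) else c x, ?_, ?_⟩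
  · intro x hx
    simp only []
    split_ifs with h
    · exact hc _ (Or.inr (he _ (hcT x h)))
    · exact hc _ (Or.inl ⟨hx, h⟩)
  · have key : ∀ x ∈ T, ∀ y ∈ F, y ∉ T → G.Adj x y → c (e (cT x)) ≠ c y := by
      intro x hx y hy hyT hxy
      have hk := he _ (hcT x hx)
      refine hc' _ (Or.inr hk) _ (Or.inl ⟨hy, hyT⟩) ?_
      rcases hom y hy hyT with h | h
      · exact (h _ (hKT hk)).symm
      · exact absurd hxy.symm (h x hx)
    intro x hx y hy hxy
    simp only []
    split_ifs with h h' h'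
    · have hkx := he _ (hcT x h)
      have hky := he _ (hcT y h')
      refine hc' _ (Or.inr hkx) _ (Or.inr hky) (hK hkx hky fun heq => ?_)
      exact hcT' x h y h' hxy (hinj _ (hcT x h) _ (hcT y h') heq)
    · exact key x h y hy h' hxy
    · exact (key y h' x hx h hxy.symm).symm
    · exact hc' _ (Or.inl ⟨hx, h⟩) _ (Or.inl ⟨hy, h'⟩) hxy

open Classical in
theorem not_subset_union (hF : IsMinimallyImperfect G F) {A B : Set V} (hA : G.IsClique A)
    (hB : G.IsClique B) : ¬ F ⊆ A ∪ B := by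
  intro hAB
  obtain ⟨m, hm, hnot⟩ := hF.exists_not_colourableOn
  have heq : F = ((Finset.univ.filter fun x => x ∈ F ∧ x ∈ A) ∪
      (Finset.univ.filter fun x => x ∈ F ∧ x ∉ A) : Finset V) := by
    ext x
    simp only [Finset.coe_union, Set.mem_union, Finset.mem_coe, Finset.mem_filter,
      Finset.mem_univ, true_and]
    tauto
  rw [heq] at hnot hm
  refine hnot (colourableOn_union_of_isClique _ _ (hA.subset ?_) (hB.subset ?_) ?_ m hm)
  · intro x hx
    simp only [Finset.coe_filter, Finset.mem_univ, true_and, Set.mem_ofPred_eq] at hx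
    exact hx.2
  · intro x hx
    simp only [Finset.coe_filter, Finset.mem_univ, true_and, Set.mem_ofPred_eq] at hx
    exact (hAB hx.1).resolve_left hx.2
  · rw [Finset.disjoint_left]
    intro x hx hx'
    simp only [Finset.mem_filter, Finset.mem_univ, true_and] at hx hx'
    exact hx'.2 hx.2

theorem not_isClique (hF : IsMinimallyImperfect G F) : ¬ G.IsClique F := fun h =>
  hF.not_subset_union h h (by simp)

theorem nonempty (hF : IsMinimallyImperfect G F) : F.Nonempty := by
  by_contra h
  rw [Set.not_nonempty_iff_eq_empty] at h
  exact hF.not_isClique (by simp [h])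

open Classical in
/-- A minimally imperfect set has no simplicial vertex. -/
theorem not_simplicial (hF : IsMinimallyImperfect G F) {r : V} (hr : r ∈ F)
    (hcl : ∀ x ∈ F, ∀ y ∈ F, G.Adj r x → G.Adj r y → x ≠ y → G.Adj x y) : False := by
  obtain ⟨m, hm, hnot⟩ := hF.exists_not_colourableOn
  have hss : F \ {r} ⊂ F := Set.sdiff_singleton_ssubset.2 hr
  have hcol := hF.colourableOn_of_ssubset _ hss m (hm.mono hss.subset le_rfl)
  refine hnot ((hcol.insert_of_card_lt (r := r) ?_).mono ?_ le_rfl)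
  · set K := Finset.univ.filter fun x => x ∈ F \ {r} ∧ G.Adj r x with hK
    have hKm : ∀ x ∈ K, x ∈ F ∧ G.Adj r x := by
      intro x hx
      simp only [hK, Finset.mem_filter, Finset.mem_univ, true_and] at hx
      exact ⟨hx.1.1, hx.2⟩
    have := hm (insert r K) (by
      intro x hx
      rcases Finset.mem_insert.1 (Finset.mem_coe.1 hx) with rfl | hx
      · exact hr
      · exact (hKm x hx).1) (by
      intro x hx y hy hxy
      rcases Finset.mem_insert.1 (Finset.mem_coe.1 hx) with rfl | hx <;>
        rcases Finset.mem_insert.1 (Finset.mem_coe.1 hy) with rfl | hy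
      · exact absurd rfl hxy
      · exact (hKm y hy).2
      · exact (hKm x hx).2.symm
      · exact hcl x (hKm x hx).1 y (hKm y hy).1 (hKm x hx).2 (hKm y hy).2 hxy)
    rw [Finset.card_insert_of_notMem (fun h => G.loopless.irrefl r (hKm r h).2)] at this
    refine lt_of_eq_of_lt ?_ (Nat.lt_of_succ_le this)
    congr
  · intro x hx
    by_cases h : x = r
    · exact Or.inl h
    · exact Or.inr ⟨hx, h⟩

theorem exists_adj_compl (hF : IsMinimallyImperfect G F) {N : Set V} (hN : N ⊆ F)
    (h0 : N.Nonempty) (h1 : N ≠ F) : ∃ y ∈ N, ∃ z ∈ F, z ∉ N ∧ G.Adj y z := by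
  by_contra! hcon
  refine hF.not_subset_union (A := N) (B := F \ N) ?_ ?_ (by simp)
  · exact hF.isClique_of_homogeneous hN h1 fun z hz hzN =>
      Or.inr fun x hx h => hcon x hx z hz hzN h.symm
  · refine hF.isClique_of_homogeneous Set.sdiff_subset (fun he => ?_) fun z hz hzN =>
      Or.inr fun x hx h => hcon z ?_ x hx.1 hx.2 h
    · obtain ⟨x, hx⟩ := h0
      have := hN hx
      rw [← he] at this
      exact this.2 hx
    · by_contra hzN'
      exact hzN ⟨hz, hzN'⟩

theorem exists_not_adj_compl (hF : IsMinimallyImperfect G F) {N : Set V} (hN : N ⊆ F)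
    (h0 : N.Nonempty) (h1 : N ≠ F) : ∃ y ∈ N, ∃ z ∈ F, z ∉ N ∧ ¬ G.Adj y z := by
  by_contra! hcon
  refine hF.not_subset_union (A := N) (B := F \ N) ?_ ?_ (by simp)
  · exact hF.isClique_of_homogeneous hN h1 fun z hz hzN =>
      Or.inl fun x hx => (hcon x hx z hz hzN).symm
  · refine hF.isClique_of_homogeneous Set.sdiff_subset (fun he => ?_) fun z hz hzN =>
      Or.inl fun x hx => hcon z ?_ x hx.1 hx.2
    · obtain ⟨x, hx⟩ := h0
      have := hN hx
      rw [← he] at this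
      exact this.2 hx
    · by_contra hzN'
      exact hzN ⟨hz, hzN'⟩

end IsMinimallyImperfect

end Minimal

section Structure

variable {V : Type*} {G : SimpleGraph V} {F : Set V}

/-- Elementwise form of having no induced fork: a claw with centre `c` and leaves `a`, `b`, `d`
does not extend to a fork by a vertex `e` attached to `d`. -/
def NoForkExtension (G : SimpleGraph V) : Prop :=
  ∀ c a b d e, G.Adj c a → G.Adj c b → G.Adj c d → G.Adj d e → ¬ G.Adj a b → ¬ G.Adj a d →
    ¬ G.Adj b d → ¬ G.Adj c e → ¬ G.Adj a e → ¬ G.Adj b e → a ≠ b → False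

/-- `S` contains no induced five-cycle. -/
def NoFiveHoleOn (G : SimpleGraph V) (S : Set V) : Prop :=
  ∀ a ∈ S, ∀ b ∈ S, ∀ c ∈ S, ∀ d ∈ S, ∀ e ∈ S, G.Adj a b → G.Adj b c → G.Adj c d → G.Adj d e →
    G.Adj e a → ¬ G.Adj a c → ¬ G.Adj a d → ¬ G.Adj b d → ¬ G.Adj b e → ¬ G.Adj c e → False

/-- `x` is adjacent to every vertex of `F`. -/
def IsCompleteTo (G : SimpleGraph V) (F : Set V) (x : V) : Prop := ∀ f ∈ F, G.Adj x f

/-- `x` lies outside `F` and has no neighbour in `F`. -/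
def IsAntiTo (G : SimpleGraph V) (F : Set V) (x : V) : Prop := x ∉ F ∧ ∀ f ∈ F, ¬ G.Adj x f

/-- `x` lies outside `F` and has both a neighbour and a non-neighbour in `F`. -/
def IsMixedOn (G : SimpleGraph V) (F : Set V) (x : V) : Prop :=
  x ∉ F ∧ ¬ IsCompleteTo G F x ∧ ¬ IsAntiTo G F x

/-- Every vertex outside `X` is complete or anticomplete to `X`. -/
def IsHomogeneous (G : SimpleGraph V) (X : Set V) : Prop :=
  ∀ z ∉ X, (∀ x ∈ X, G.Adj z x) ∨ (∀ x ∈ X, ¬ G.Adj z x)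

theorem IsCompleteTo.notMem {x : V} (hx : IsCompleteTo G F x) : x ∉ F := fun h =>
  (hx x h).ne rfl

theorem IsAntiTo.ne_of_mem {o x : V} (ho : IsAntiTo G F o) (hx : x ∈ F) : o ≠ x := fun h =>
  ho.1 (h ▸ hx)

theorem IsMixedOn.exists_adj {j : V} (hj : IsMixedOn G F j) : ∃ f ∈ F, G.Adj j f := by
  by_contra! h
  exact hj.2.2 ⟨hj.1, h⟩

theorem IsMixedOn.exists_not_adj {j : V} (hj : IsMixedOn G F j) : ∃ f ∈ F, ¬ G.Adj j f := by
  by_contra! h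
  exact hj.2.1 h

variable [Fintype V]

theorem IsMinimallyImperfect.exists_not_adj (hF : IsMinimallyImperfect G F) :
    ∃ q ∈ F, ∃ q' ∈ F, q ≠ q' ∧ ¬ G.Adj q q' := by
  by_contra! h
  exact hF.not_isClique fun x hx y hy hxy => h x hx y hy hxy

theorem IsMinimallyImperfect.not_isAntiTo_of_isCompleteTo (hF : IsMinimallyImperfect G F) {x : V}
    (hx : IsCompleteTo G F x) : ¬ IsAntiTo G F x := by
  intro h
  obtain ⟨f, hf⟩ := hF.nonempty
  exact h.2 f hf (hx f hf)

theorem adj_of_adj_isAntiTo (hfork : NoForkExtension G) (hF : IsMinimallyImperfect G F) {o u : V}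
    (ho : IsAntiTo G F o) (huo : G.Adj u o) (hu : ¬ IsCompleteTo G F u) {x y : V} (hx : x ∈ F)
    (hy : y ∈ F) (hux : G.Adj u x) (huy : G.Adj u y) (hxy : x ≠ y) : G.Adj x y := by
  by_contra hnot
  obtain ⟨q, hq, huq⟩ : ∃ q ∈ F, ¬ G.Adj u q := by
    by_contra! h
    exact hu h
  set R : V → V → Prop := fun s t => t ∈ F ∧ G.Adj u t ∧ ¬ G.Adj s t ∧ s ≠ t with hR
  set T : Set V := {t | Relation.ReflTransGen R x t} with hT
  have hTm : ∀ t ∈ T, t ∈ F ∧ G.Adj u t := by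
    intro t ht
    rcases Relation.ReflTransGen.cases_tail ht with h | ⟨s, -, h⟩
    · rw [h]
      exact ⟨hx, hux⟩
    · exact ⟨h.1, h.2.1⟩
  have hcl : G.IsClique T := by
    refine hF.isClique_of_homogeneous (fun t ht => (hTm t ht).1) ?_ ?_
    · intro he
      rw [← he] at hq
      exact huq (hTm q hq).2
    · intro z hz hzT
      by_cases huz : G.Adj u z
      · left
        intro t ht
        by_contra hzt
        exact hzT (Relation.ReflTransGen.tail ht
          ⟨hz, huz, fun h => hzt h.symm, fun h => hzT (h ▸ ht)⟩)
      · have key : ∀ t ∈ T, (G.Adj z t ↔ G.Adj z x) := by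
          intro t ht
          induction ht with
          | refl => rfl
          | @tail s t hs hst ih =>
            rw [← ih]
            have hs' := hTm s hs
            constructor
            · intro h
              by_contra h'
              exact hfork u o s t z huo hs'.2 hst.2.1 h.symm (ho.2 s hs'.1) (ho.2 t hst.1)
                hst.2.2.1 huz (ho.2 z hz) (fun h => h' h.symm) (ho.ne_of_mem hs'.1)
            · intro h
              by_contra h'
              exact hfork u o t s z huo hst.2.1 hs'.2 h.symm (ho.2 t hst.1) (ho.2 s hs'.1)
                (fun h => hst.2.2.1 h.symm) huz (ho.2 z hz) (fun h => h' h.symm)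
                (ho.ne_of_mem hst.1)
        by_cases hzx : G.Adj z x
        · exact Or.inl fun t ht => (key t ht).2 hzx
        · exact Or.inr fun t ht h => hzx ((key t ht).1 h)
  exact hnot (hcl (Relation.ReflTransGen.refl : x ∈ T)
    (Relation.ReflTransGen.single ⟨hy, huy, hnot, hxy⟩ : y ∈ T) hxy)

theorem exists_not_adj_pair (hfork : NoForkExtension G) (hF : IsMinimallyImperfect G F) {o u : V}
    (ho : IsAntiTo G F o) (huo : G.Adj u o) (hu : ¬ IsCompleteTo G F u) :
    ∃ q ∈ F, ∃ q' ∈ F, ¬ G.Adj u q ∧ ¬ G.Adj u q' ∧ q ≠ q' ∧ ¬ G.Adj q q' := by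
  by_contra! h
  refine hF.not_subset_union (A := {x | x ∈ F ∧ G.Adj u x}) (B := {x | x ∈ F ∧ ¬ G.Adj u x})
    ?_ ?_ ?_
  · exact fun x hx y hy hxy => adj_of_adj_isAntiTo hfork hF ho huo hu hx.1 hy.1 hx.2 hy.2 hxy
  · exact fun x hx y hy hxy => h x hx.1 y hy.1 hx.2 hy.2 hxy
  · intro x hx
    by_cases hux : G.Adj u x
    · exact Or.inl ⟨hx, hux⟩
    · exact Or.inr ⟨hx, hux⟩

theorem adj_of_common_isAntiTo (hfork : NoForkExtension G) (hF : IsMinimallyImperfect G F)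
    {o p u : V} (ho : IsAntiTo G F o) (hp : IsCompleteTo G F p) (hpo : G.Adj p o)
    (huo : G.Adj u o) (hu : ¬ IsCompleteTo G F u) : G.Adj p u := by
  by_contra hpu
  obtain ⟨q, hq, q', hq', h1, h2, h3, h4⟩ := exists_not_adj_pair hfork hF ho huo hu
  exact hfork p q q' o u (hp q hq) (hp q' hq') hpo huo.symm h4 (fun h => ho.2 q hq h.symm)
    (fun h => ho.2 q' hq' h.symm) hpu (fun h => h1 h.symm) (fun h => h2 h.symm) h3

theorem adj_of_adj_isAntiTo_isAntiTo (hfork : NoForkExtension G) (hF : IsMinimallyImperfect G F)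
    {o o' p : V} (ho : IsAntiTo G F o) (ho' : IsAntiTo G F o') (hp : IsCompleteTo G F p)
    (hpo : G.Adj p o) (hoo' : G.Adj o o') : G.Adj p o' := by
  by_contra hpo'
  obtain ⟨q, hq, q', hq', h1, h2⟩ := hF.exists_not_adj
  exact hfork p q q' o o' (hp q hq) (hp q' hq') hpo hoo' h2 (fun h => ho.2 q hq h.symm)
    (fun h => ho.2 q' hq' h.symm) hpo' (fun h => ho'.2 q hq h.symm)
    (fun h => ho'.2 q' hq' h.symm) h1

theorem adj_isMixedOn (hfork : NoForkExtension G) (hF : IsMinimallyImperfect G F)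
    {o p j : V} (ho : IsAntiTo G F o) (hp : IsCompleteTo G F p) (hpo : G.Adj p o)
    (hj : IsMixedOn G F j) : G.Adj p j := by
  by_cases hjo : G.Adj j o
  · exact adj_of_common_isAntiTo hfork hF ho hp hpo hjo hj.2.1
  by_contra hpj
  obtain ⟨f, hf, hjf⟩ := hj.exists_adj
  obtain ⟨g, hg, hjg⟩ := hj.exists_not_adj
  obtain ⟨x, hx, y, hy, hyN, hxy⟩ := hF.exists_not_adj_compl (N := {x | x ∈ F ∧ G.Adj j x})
    (fun x hx => hx.1) ⟨f, hf, hjf⟩ (fun he => hjg (by rw [← he] at hg; exact hg.2))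
  have hjy : ¬ G.Adj j y := fun h => hyN ⟨hy, h⟩
  exact hfork p o y x j hpo (hp y hy) (hp x hx.1) hx.2.symm (ho.2 y hy) (ho.2 x hx.1)
    (fun h => hxy h.symm) hpj (fun h => hjo h.symm) (fun h => hjy h.symm) (ho.ne_of_mem hy)

theorem IsMinimallyImperfect.exists_adj_split (hF : IsMinimallyImperfect G F) {j : V}
    (hj : IsMixedOn G F j) :
    ∃ f ∈ F, ∃ f' ∈ F, G.Adj j f ∧ ¬ G.Adj j f' ∧ G.Adj f f' := by
  obtain ⟨f, hf, hjf⟩ := hj.exists_adj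
  obtain ⟨g, hg, hjg⟩ := hj.exists_not_adj
  obtain ⟨x, hx, y, hy, hyN, hxy⟩ := hF.exists_adj_compl (N := {x | x ∈ F ∧ G.Adj j x})
    (fun x hx => hx.1) ⟨f, hf, hjf⟩ (fun he => hjg (by rw [← he] at hg; exact hg.2))
  exact ⟨x, hx.1, y, hy, hx.2, fun h => hyN ⟨hy, h⟩, hxy⟩

theorem not_adj_isMixedOn_of_isAntiTo_pair (hfork : NoForkExtension G)
    (hF : IsMinimallyImperfect G F) {j o o' : V} (hj : IsMixedOn G F j) (ho : IsAntiTo G F o)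
    (ho' : IsAntiTo G F o') (hoo' : ¬ G.Adj o o') (hne : o ≠ o') (h1 : G.Adj j o)
    (h2 : G.Adj j o') : False := by
  obtain ⟨f, hf, f', hf', h3, h4, h5⟩ := hF.exists_adj_split hj
  exact hfork j o o' f f' h1 h2 h3 h5 hoo' (ho.2 f hf) (ho'.2 f hf) h4 (ho.2 f' hf')
    (ho'.2 f' hf') hne

theorem adj_isAntiTo_of_adj_isMixedOn (hfork : NoForkExtension G) (hF : IsMinimallyImperfect G F)
    {o o₁ p j : V} (ho : IsAntiTo G F o) (hj : IsMixedOn G F j) (hoj : G.Adj o j)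
    (hp : IsCompleteTo G F p) (ho₁ : IsAntiTo G F o₁) (hpo₁ : G.Adj p o₁) : G.Adj p o := by
  by_contra hpo
  have hpj := adj_isMixedOn hfork hF ho₁ hp hpo₁ hj
  have hoo₁ : ¬ G.Adj o o₁ := fun h =>
    hpo (adj_of_adj_isAntiTo_isAntiTo hfork hF ho₁ ho hp hpo₁ h.symm)
  have hne : o ≠ o₁ := fun h => hpo (h ▸ hpo₁)
  by_cases hjo₁ : G.Adj j o₁
  · exact not_adj_isMixedOn_of_isAntiTo_pair hfork hF hj ho ho₁ hoo₁ hne hoj.symm hjo₁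
  · obtain ⟨q, hq, hjq⟩ := hj.exists_not_adj
    exact hfork p q o₁ j o (hp q hq) hpo₁ hpj hoj.symm (fun h => ho₁.2 q hq h.symm)
      (fun h => hjq h.symm) (fun h => hjo₁ h.symm) hpo (fun h => ho.2 q hq h.symm)
      (fun h => hoo₁ h.symm) (ho₁.ne_of_mem hq).symm

/-- If the vertices of `F` having property `S` attach to suitable neighbours of `o` which miss the
remaining vertices of `F`, then either all or none of the vertices of `F` have property `S`. -/
theorem forall_of_attached (hfork : NoForkExtension G) (hF : IsMinimallyImperfect G F) {o : V}
    (ho : IsAntiTo G F o) (S : V → Prop) (hS : ∃ s ∈ F, S s)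
    (hpair : ∀ s ∈ F, S s → ∃ x y, x ≠ y ∧ ¬ G.Adj x y ∧ G.Adj s x ∧ G.Adj s y ∧ G.Adj o x ∧
      ∀ r ∈ F, ¬ S r → ¬ G.Adj x r ∧ ¬ G.Adj y r)
    (hcommon : ∀ s ∈ F, ∀ s' ∈ F, S s → S s' → ∃ x, G.Adj o x ∧ G.Adj x s ∧ G.Adj x s' ∧
      ∀ r ∈ F, ¬ S r → ¬ G.Adj x r) : ∀ f ∈ F, S f := by
  by_contra! hcon
  obtain ⟨r₀, hr₀, hr₀S⟩ := hcon
  obtain ⟨s₁, hs₁, hs₁S⟩ := hS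
  obtain ⟨s₀, ⟨hs₀, hs₀S⟩, r, hr, hrN, hs₀r⟩ := hF.exists_adj_compl (N := {x | x ∈ F ∧ S x})
    (fun x hx => hx.1) ⟨s₁, hs₁, hs₁S⟩ (fun he => hr₀S (by rw [← he] at hr₀; exact hr₀.2))
  have hrS : ¬ S r := fun h => hrN ⟨hr, h⟩
  have fact1 : ∀ s ∈ F, S s → G.Adj r s → ∀ s' ∈ F, S s' → ¬ G.Adj r s' → G.Adj s' s := by
    intro s hs hsS hrs s' hs' hs'S hrs'
    by_contra h
    obtain ⟨x, hox, hxs, hxs', hx⟩ := hcommon s hs s' hs' hsS hs'S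
    exact hfork x o s' s r hox.symm hxs' hxs hrs.symm (ho.2 s' hs') (ho.2 s hs) h
      (hx r hr hrS) (ho.2 r hr) (fun h => hrs' h.symm) (ho.ne_of_mem hs')
  have fact2 : ∀ s ∈ F, S s → ∀ r ∈ F, ¬ S r → ∀ r' ∈ F, ¬ S r' → r ≠ r' → G.Adj s r →
      G.Adj s r' → G.Adj r r' := by
    intro s hs hsS r hr hrS r' hr' hr'S hne hsr hsr'
    by_contra h
    obtain ⟨x, y, -, -, hsx, -, hox, hx⟩ := hpair s hs hsS
    exact hfork s r r' x o hsr hsr' hsx hox.symm h (fun h => (hx r hr hrS).1 h.symm)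
      (fun h => (hx r' hr' hr'S).1 h.symm) (fun h => ho.2 s hs h.symm)
      (fun h => ho.2 r hr h.symm) (fun h => ho.2 r' hr' h.symm) hne
  have fact3 : ∀ s ∈ F, S s → G.Adj r s → ∀ r' ∈ F, ¬ S r' → G.Adj r r' → G.Adj r' s := by
    intro s hs hsS hrs r' hr' hr'S hrr'
    by_contra h
    obtain ⟨x, y, hne, hxy, hsx, hsy, -, hx⟩ := hpair s hs hsS
    exact hfork s x y r r' hsx hsy hrs.symm hrr' hxy (hx r hr hrS).1 (hx r hr hrS).2
      (fun h' => h h'.symm) (hx r' hr' hr'S).1 (hx r' hr' hr'S).2 hne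
  have hcl : G.IsClique {s | s ∈ F ∧ S s ∧ G.Adj r s} := by
    refine hF.isClique_of_homogeneous (fun x hx => hx.1) ?_ ?_
    · intro he
      have := hr
      rw [← he] at this
      exact hrS this.2.1
    · intro z hz hzN
      by_cases hzS : S z
      · exact Or.inl fun s hs => fact1 s hs.1 hs.2.1 hs.2.2 z hz hzS fun h => hzN ⟨hz, hzS, h⟩
      by_cases hzr : z = r
      · rw [hzr]
        exact Or.inl fun s hs => hs.2.2
      by_cases hex : ∃ s ∈ F, S s ∧ G.Adj r s ∧ G.Adj z s
      · obtain ⟨s, hs, hsS, hrs, hzs⟩ := hex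
        have hrz := fact2 s hs hsS r hr hrS z hz hzS (Ne.symm hzr) hrs.symm hzs.symm
        exact Or.inl fun s hs => fact3 s hs.1 hs.2.1 hs.2.2 z hz hzS hrz
      · exact Or.inr fun s hs h => hex ⟨s, hs.1, hs.2.1, hs.2.2, h⟩
  refine hF.not_simplicial hr fun x hx y hy hrx hry hxy => ?_
  by_cases hxS : S x <;> by_cases hyS : S y
  · exact hcl ⟨hx, hxS, hrx⟩ ⟨hy, hyS, hry⟩ hxy
  · exact (fact3 x hx hxS hrx y hy hyS hry).symm
  · exact fact3 y hy hyS hry x hx hxS hrx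
  · exact fact2 s₀ hs₀ hs₀S x hx hxS y hy hyS hxy (fact3 s₀ hs₀ hs₀S hs₀r.symm x hx hxS hrx).symm
      (fact3 s₀ hs₀ hs₀S hs₀r.symm y hy hyS hry).symm

/-- Some vertex complete to `F` has a neighbour anticomplete to `F`. -/
theorem exists_isCompleteTo_adj_isAntiTo (hfork : NoForkExtension G)
    (hF : IsMinimallyImperfect G F)
    (hhom : ∀ X : Set V, IsHomogeneous G X → X ≠ Set.univ → G.IsClique X)
    (htri : ∀ v, ∃ a b d, G.Adj v a ∧ G.Adj v b ∧ G.Adj v d ∧ a ≠ b ∧ a ≠ d ∧ b ≠ d ∧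
      ¬ G.Adj a b ∧ ¬ G.Adj a d ∧ ¬ G.Adj b d) {v : V} (hv : IsAntiTo G F v) :
    ∃ p o, IsCompleteTo G F p ∧ IsAntiTo G F o ∧ G.Adj p o := by
  by_contra! hP
  obtain ⟨o, j, ho, hjF, hj, hoj⟩ : ∃ o j, IsAntiTo G F o ∧ j ∉ F ∧ ¬ IsAntiTo G F j ∧
      G.Adj o j := by
    by_contra! hcon
    have hcl := hhom {x | ¬ IsAntiTo G F x} (by
      intro z hz
      have hz' : IsAntiTo G F z := not_not.1 hz
      right
      intro x hx h
      by_cases hxF : x ∈ F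
      · exact hz'.2 x hxF h
      · exact hcon z x hz' hxF hx h) (fun he => by
        have : v ∈ {x | ¬ IsAntiTo G F x} := he ▸ Set.mem_univ v
        exact this hv)
    exact hF.not_isClique (hcl.subset (show F ⊆ _ from fun x hx (h : IsAntiTo G F x) => h.1 hx))
  have hjm : IsMixedOn G F j := ⟨hjF, fun h => hP j o h ho hoj.symm, hj⟩
  obtain ⟨a, b, d, hoa, hob, hod, hab, had, hbd, hab', had', hbd'⟩ := htri o
  have hnc : ∀ x, G.Adj o x → ¬ IsCompleteTo G F x := fun x hx h => hP x o h ho hx.symm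
  have hnF : ∀ x, G.Adj o x → x ∉ F := fun x hx h => ho.2 x h hx
  obtain ⟨f₀, hf₀, hf₀'⟩ : ∃ f ∈ F, G.Adj a f ∨ G.Adj b f ∨ G.Adj d f := by
    by_contra! hcon
    have ha : IsAntiTo G F a := ⟨hnF a hoa, fun f hf => (hcon f hf).1⟩
    have hb : IsAntiTo G F b := ⟨hnF b hob, fun f hf => (hcon f hf).2.1⟩
    have hd : IsAntiTo G F d := ⟨hnF d hod, fun f hf => (hcon f hf).2.2⟩
    have key1 := fun x y (hx : IsAntiTo G F x) (hy : IsAntiTo G F y) (hxy : ¬ G.Adj x y)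
      (hne : x ≠ y) (h1 : G.Adj j x) (h2 : G.Adj j y) =>
      not_adj_isMixedOn_of_isAntiTo_pair hfork hF hjm hx hy hxy hne h1 h2
    have key2 : ∀ x y, IsAntiTo G F x → IsAntiTo G F y → G.Adj o x → G.Adj o y → ¬ G.Adj x y →
        x ≠ y → ¬ G.Adj j x → ¬ G.Adj j y → False := by
      intro x y hx hy hox hoy hxy hne h1 h2
      obtain ⟨f, hf, hjf⟩ := hjm.exists_adj
      exact hfork o x y j f hox hoy hoj hjf hxy (fun h => h1 h.symm) (fun h => h2 h.symm)
        (ho.2 f hf) (hx.2 f hf) (hy.2 f hf) hne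
    by_cases h1 : G.Adj j a <;> by_cases h2 : G.Adj j b
    · exact key1 a b ha hb hab' hab h1 h2
    · by_cases h3 : G.Adj j d
      · exact key1 a d ha hd had' had h1 h3
      · exact key2 b d hb hd hob hod hbd' hbd h2 h3
    · by_cases h3 : G.Adj j d
      · exact key1 b d hb hd hbd' hbd h2 h3
      · exact key2 a d ha hd hoa hod had' had h1 h3
    · exact key2 a b ha hb hoa hob hab' hab h1 h2
  have htwo : ∀ x y z, G.Adj o x → G.Adj o y → G.Adj o z → ¬ G.Adj x y → ¬ G.Adj x z →
      ¬ G.Adj y z → y ≠ z → ∀ f ∈ F, G.Adj x f → G.Adj y f ∨ G.Adj z f := by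
    intro x y z hox hoy hoz hxy hxz hyz hne f hf hxf
    by_contra! h
    exact hfork o y z x f hoy hoz hox hxf hyz (fun h => hxy h.symm) (fun h => hxz h.symm)
      (ho.2 f hf) h.1 h.2 hne
  have hta := htwo a b d hoa hob hod hab' had' hbd' hbd
  have htb := htwo b a d hob hoa hod (fun h => hab' h.symm) hbd' had' had
  have htd := htwo d a b hod hoa hob (fun h => had' h.symm) (fun h => hbd' h.symm) hab' hab
  have hall := forall_of_attached hfork hF ho (fun f => G.Adj a f ∨ G.Adj b f ∨ G.Adj d f)
    ⟨f₀, hf₀, hf₀'⟩ (by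
      intro s hs hsS
      have hr : ∀ r ∈ F, ¬ (G.Adj a r ∨ G.Adj b r ∨ G.Adj d r) →
        ¬ G.Adj a r ∧ ¬ G.Adj b r ∧ ¬ G.Adj d r :=
        fun r _ h => by simpa only [not_or] using h
      by_cases h1 : G.Adj a s
      · by_cases h2 : G.Adj b s
        · exact ⟨a, b, hab, hab', h1.symm, h2.symm, hoa, fun r hrF h =>
            ⟨(hr r hrF h).1, (hr r hrF h).2.1⟩⟩
        · have h3 : G.Adj d s := (hta s hs h1).resolve_left h2
          exact ⟨a, d, had, had', h1.symm, h3.symm, hoa, fun r hrF h =>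
            ⟨(hr r hrF h).1, (hr r hrF h).2.2⟩⟩
      · have h23 : G.Adj b s ∧ G.Adj d s := by
          rcases hsS with h | h | h
          · exact absurd h h1
          · exact ⟨h, (htb s hs h).resolve_left h1⟩
          · exact ⟨(htd s hs h).resolve_left h1, h⟩
        obtain ⟨h2, h3⟩ := h23
        exact ⟨b, d, hbd, hbd', h2.symm, h3.symm, hob, fun r hrF h =>
            ⟨(hr r hrF h).2.1, (hr r hrF h).2.2⟩⟩) (by
      intro s hs s' hs' hsS hs'S
      have hta' := hta s' hs'
      have htb' := htb s' hs'
      have htd' := htd s' hs'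
      have hta := hta s hs
      have htb := htb s hs
      have htd := htd s hs
      by_cases h1 : G.Adj a s ∧ G.Adj a s'
      · exact ⟨a, hoa, h1.1, h1.2, fun r hrF h h' => h (Or.inl h')⟩
      by_cases h2 : G.Adj b s ∧ G.Adj b s'
      · exact ⟨b, hob, h2.1, h2.2, fun r hrF h h' => h (Or.inr (Or.inl h'))⟩
      · have h3 : G.Adj d s ∧ G.Adj d s' := by
          clear htwo hnc hnF hf₀' hfork hhom htri hP
          grind
        exact ⟨d, hod, h3.1, h3.2, fun r hrF h h' => h (Or.inr (Or.inr h'))⟩)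
  refine hF.not_subset_union (A := {x | x ∈ F ∧ G.Adj a x}) (B := {x | x ∈ F ∧ G.Adj b x})
    ?_ ?_ ?_
  · exact fun x hx y hy hxy =>
      adj_of_adj_isAntiTo hfork hF ho hoa.symm (hnc a hoa) hx.1 hy.1 hx.2 hy.2 hxy
  · exact fun x hx y hy hxy =>
      adj_of_adj_isAntiTo hfork hF ho hob.symm (hnc b hob) hx.1 hy.1 hx.2 hy.2 hxy
  · intro x hx
    have := hall x hx
    have hd := htd x hx
    by_cases hax : G.Adj a x
    · exact Or.inl ⟨hx, hax⟩
    · exact Or.inr ⟨hx, (this.resolve_left hax).elim id fun h => (hd h).resolve_left hax⟩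

/-- Vertices outside `F` that are not complete to `F` cannot be isolated from the vertices
anticomplete to `F`. -/
theorem exists_isMixedOn_adj_isAntiTo (hfork : NoForkExtension G)
    (hF : IsMinimallyImperfect G F)
    (hhom : ∀ X : Set V, IsHomogeneous G X → X ≠ Set.univ → G.IsClique X) {v : V}
    (hv : IsAntiTo G F v) : ∃ o j, IsAntiTo G F o ∧ IsMixedOn G F j ∧ G.Adj o j := by
  by_contra! hcon
  set P₀ : V → Prop := fun w => IsCompleteTo G F w ∧ ∀ o, IsAntiTo G F o → ¬ G.Adj w o with hP₀
  set L : V → Prop := fun t => t ∈ F ∨ IsMixedOn G F t ∨ P₀ t with hL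
  set R : V → V → Prop := fun s t => L t ∧ ¬ G.Adj s t ∧ s ≠ t with hR
  set X : Set V := {t | ∃ f ∈ F, Relation.ReflTransGen R f t} with hX
  have hFX : F ⊆ X := fun f hf => ⟨f, hf, Relation.ReflTransGen.refl⟩
  have hLo : ∀ t, L t → ∀ o, IsAntiTo G F o → ¬ G.Adj o t := by
    rintro t (ht | ht | ht) o ho
    · exact ho.2 t ht
    · exact hcon o t ho ht
    · exact fun h => ht.2 o ho h.symm
  have hLne : ∀ t, L t → ¬ IsAntiTo G F t := by
    rintro t (ht | ht | ht) ho
    · exact ho.1 ht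
    · exact ht.2.2 ho
    · exact hF.not_isAntiTo_of_isCompleteTo ht.1 ho
  have hXL : ∀ t ∈ X, L t := by
    rintro t ⟨f, hf, ht⟩
    rcases Relation.ReflTransGen.cases_tail ht with h | ⟨s, -, h⟩
    · rw [h]
      exact Or.inl hf
    · exact h.1
  have key : ∀ p o, IsCompleteTo G F p → IsAntiTo G F o → G.Adj p o → ∀ t ∈ X,
      G.Adj p t ∧ ∀ w, P₀ w → ¬ G.Adj p w → G.Adj w t := by
    rintro p o hp ho hpo t ⟨f, hf, ht⟩
    induction ht with
    | refl => exact ⟨hp f hf, fun w hw _ => hw.1 f hf⟩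
    | @tail s t hs hst ih =>
      have hsL : L s := hXL s ⟨f, hf, hs⟩
      have hpt : G.Adj p t := by
        rcases hst.1 with h | h | h
        · exact hp t h
        · exact adj_isMixedOn hfork hF ho hp hpo h
        · by_contra hpt
          exact hst.2.1 (ih.2 t h hpt).symm
      refine ⟨hpt, fun w hw hpw => ?_⟩
      by_contra hwt
      exact hfork p o t s w hpo hpt ih.1 (ih.2 w hw hpw).symm (hLo t hst.1 o ho)
        (hLo s hsL o ho) (fun h => hst.2.1 h.symm) hpw (fun h => hw.2 o ho h.symm)
        (fun h => hwt h.symm) (fun h => hLne t hst.1 (h ▸ ho))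
  have hcl := hhom X (by
    intro z hz
    by_cases hzA : IsAntiTo G F z
    · exact Or.inr fun x hx => hLo x (hXL x hx) z hzA
    left
    by_cases hzL : L z
    · rintro x ⟨f, hf, hx⟩
      by_contra hzx
      exact hz ⟨f, hf, hx.tail ⟨hzL, fun h => hzx h.symm, fun h => hz (h ▸ ⟨f, hf, hx⟩)⟩⟩
    · have hzF : z ∉ F := fun h => hzL (Or.inl h)
      have hzC : IsCompleteTo G F z := by
        by_contra h
        exact hzL (Or.inr (Or.inl ⟨hzF, h, hzA⟩))
      obtain ⟨o, ho, hzo⟩ : ∃ o, IsAntiTo G F o ∧ G.Adj z o := by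
        by_contra! h
        exact hzL (Or.inr (Or.inr ⟨hzC, h⟩))
      exact fun x hx => (key z o hzC ho hzo x hx).1) (fun he => by
    have : v ∈ X := he ▸ Set.mem_univ v
    exact hLne v (hXL v this) hv)
  exact hF.not_isClique (hcl.subset hFX)

theorem exists_isClique_cover (h5 : NoFiveHoleOn G F) {N : V → Prop}
    (hN : ∀ x ∈ F, ∀ y ∈ F, N x → N y → x ≠ y → G.Adj x y)
    (hA : ∀ y ∈ F, N y → ∀ q ∈ F, ∀ q' ∈ F, ¬ N q → ¬ N q' → q ≠ q' → G.Adj y q → G.Adj y q' →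
      G.Adj q q')
    (hB : ∀ y ∈ F, N y → ∀ q ∈ F, ∀ q' ∈ F, ¬ N q → ¬ N q' → q ≠ q' → ¬ G.Adj y q →
      ¬ G.Adj y q' → G.Adj q q')
    {k₁ k₂ y₀ : V} (hk₁ : k₁ ∈ F) (hk₂ : k₂ ∈ F) (hk₁N : ¬ N k₁) (hk₂N : ¬ N k₂)
    (hk : k₁ ≠ k₂) (hk' : ¬ G.Adj k₁ k₂) (hy₀ : y₀ ∈ F) (hy₀N : N y₀) (hy₀k : ¬ G.Adj y₀ k₁) :
    ∃ A B : Set V, G.IsClique A ∧ G.IsClique B ∧ F ⊆ A ∪ B := by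
  set U : V → Prop := fun q => ∃ y ∈ F, N y ∧ ¬ G.Adj y k₁ ∧ ¬ G.Adj y q with hU
  refine ⟨{x | x ∈ F ∧ ((N x ∧ ¬ G.Adj x k₁) ∨ (¬ N x ∧ ¬ U x))},
    {x | x ∈ F ∧ ((N x ∧ G.Adj x k₁) ∨ (¬ N x ∧ U x))}, ?_, ?_, ?_⟩
  · rintro x ⟨hx, hx'⟩ y ⟨hy, hy'⟩ hxy
    have key : ∀ x ∈ F, ∀ y ∈ F, N x → ¬ G.Adj x k₁ → ¬ U y → G.Adj x y := by
      intro x hx y hy h1 h2 h3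
      by_contra h
      exact h3 ⟨x, hx, h1, h2, h⟩
    rcases hx' with hx' | hx' <;> rcases hy' with hy' | hy'
    · exact hN x hx y hy hx'.1 hy'.1 hxy
    · exact key x hx y hy hx'.1 hx'.2 hy'.2
    · exact (key y hy x hx hy'.1 hy'.2 hx'.2).symm
    · exact hA y₀ hy₀ hy₀N x hx y hy hx'.1 hy'.1 hxy (key y₀ hy₀ x hx hy₀N hy₀k hx'.2)
        (key y₀ hy₀ y hy hy₀N hy₀k hy'.2)
  · have key1 : ∀ y' ∈ F, ∀ q ∈ F, N y' → G.Adj y' k₁ → ¬ N q → U q → G.Adj y' q := by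
      rintro y' hy' q hq hy'N hy'k hqN ⟨y, hy, hyN, hyk, hyq⟩
      by_contra hy'q
      have hyk₂ : G.Adj y k₂ := by
        by_contra h
        exact hk' (hB y hy hyN k₁ hk₁ k₂ hk₂ hk₁N hk₂N hk hyk h)
      have hy'k₂ : ¬ G.Adj y' k₂ := fun h =>
        hk' (hA y' hy' hy'N k₁ hk₁ k₂ hk₂ hk₁N hk₂N hk hy'k h)
      exact h5 y hy y' hy' k₁ hk₁ q hq k₂ hk₂
        (hN y hy y' hy' hyN hy'N fun h => hyk (h ▸ hy'k)) hy'k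
        (hB y hy hyN k₁ hk₁ q hq hk₁N hqN (fun h => hy'q (h ▸ hy'k)) hyk hyq)
        (hB y' hy' hy'N q hq k₂ hk₂ hqN hk₂N (fun h => hyq (h ▸ hyk₂)) hy'q hy'k₂)
        hyk₂.symm hyk hyq hy'q hy'k₂ hk'
    have key2 : ∀ q ∈ F, ∀ q' ∈ F, ¬ N q → ¬ N q' → U q' → ¬ G.Adj q q' → ¬ G.Adj y₀ q →
        G.Adj y₀ q' → q ≠ q' → False := by
      rintro q hq q' hq' hqN hq'N ⟨y, hy, hyN, hyk, hyq'⟩ hqq' hy₀q hy₀q' hne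
      have hyq : G.Adj y q := by
        by_contra h
        exact hqq' (hB y hy hyN q hq q' hq' hqN hq'N hne h hyq')
      exact h5 y₀ hy₀ q' hq' k₁ hk₁ q hq y hy hy₀q'
        (hB y hy hyN q' hq' k₁ hk₁ hq'N hk₁N (fun h => hy₀k (h ▸ hy₀q')) hyq' hyk)
        (hB y₀ hy₀ hy₀N k₁ hk₁ q hq hk₁N hqN (fun h => hyk (h ▸ hyq)) hy₀k hy₀q)
        hyq.symm (hN y hy y₀ hy₀ hyN hy₀N fun h => hyq' (h ▸ hy₀q')) hy₀k hy₀q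
        (fun h => hqq' h.symm) (fun h => hyq' h.symm) (fun h => hyk h.symm)
    rintro x ⟨hx, hx'⟩ y ⟨hy, hy'⟩ hxy
    rcases hx' with hx' | hx' <;> rcases hy' with hy' | hy'
    · exact hN x hx y hy hx'.1 hy'.1 hxy
    · exact key1 x hx y hy hx'.1 hx'.2 hy'.1 hy'.2
    · exact (key1 y hy x hx hy'.1 hy'.2 hx'.1 hx'.2).symm
    · by_contra hnot
      by_cases h1 : G.Adj y₀ x <;> by_cases h2 : G.Adj y₀ y
      · exact hnot (hA y₀ hy₀ hy₀N x hx y hy hx'.1 hy'.1 hxy h1 h2)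
      · exact key2 y hy x hx hy'.1 hx'.1 hx'.2 (fun h => hnot h.symm) h2 h1 hxy.symm
      · exact key2 x hx y hy hx'.1 hy'.1 hy'.2 hnot h1 h2 hxy
      · exact hnot (hB y₀ hy₀ hy₀N x hx y hy hx'.1 hy'.1 hxy h1 h2)
  · intro x hx
    by_cases h1 : N x <;> by_cases h2 : G.Adj x k₁ <;> by_cases h3 : U x
    all_goals first
      | exact Or.inl ⟨hx, Or.inl ⟨h1, h2⟩⟩
      | exact Or.inl ⟨hx, Or.inr ⟨h1, h3⟩⟩
      | exact Or.inr ⟨hx, Or.inl ⟨h1, h2⟩⟩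
      | exact Or.inr ⟨hx, Or.inr ⟨h1, h3⟩⟩

/-- In a graph without induced forks whose proper homogeneous sets are cliques, a minimally
imperfect set without five-holes is not anticomplete to any vertex. -/
theorem IsMinimallyImperfect.not_isAntiTo (hfork : NoForkExtension G)
    (hpara : ∀ p o, IsCompleteTo G F p → IsAntiTo G F o → G.Adj p o → NoFiveHoleOn G F)
    (hF : IsMinimallyImperfect G F)
    (hhom : ∀ X : Set V, IsHomogeneous G X → X ≠ Set.univ → G.IsClique X)
    (htri : ∀ v, ∃ a b d, G.Adj v a ∧ G.Adj v b ∧ G.Adj v d ∧ a ≠ b ∧ a ≠ d ∧ b ≠ d ∧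
      ¬ G.Adj a b ∧ ¬ G.Adj a d ∧ ¬ G.Adj b d) (v : V) : ¬ IsAntiTo G F v := by
  intro hv
  obtain ⟨p, o₁, hp, ho₁, hpo₁⟩ := exists_isCompleteTo_adj_isAntiTo hfork hF hhom htri hv
  obtain ⟨o, j, ho, hj, hoj⟩ := exists_isMixedOn_adj_isAntiTo hfork hF hhom hv
  have h5 := hpara p o₁ hp ho₁ hpo₁
  have hP₀ : ∀ w, IsCompleteTo G F w → ∃ o, IsAntiTo G F o ∧ G.Adj w o := by
    intro w hw
    by_contra! hwo
    obtain ⟨q, hq, q', hq', hjq, hjq', hqq', hqq⟩ :=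
      exists_not_adj_pair hfork hF ho hoj.symm hj.2.1
    by_cases hwj : G.Adj w j
    · exact hfork w q q' j o (hw q hq) (hw q' hq') hwj hoj.symm hqq (fun h => hjq h.symm)
        (fun h => hjq' h.symm) (hwo o ho) (fun h => ho.2 q hq h.symm)
        (fun h => ho.2 q' hq' h.symm) hqq'
    have hN : ∀ x ∈ F, ∀ y ∈ F, G.Adj j x → G.Adj j y → x ≠ y → G.Adj x y := by
      intro x hx y hy hjx hjy hxy
      exact adj_of_adj_isAntiTo hfork hF ho hoj.symm hj.2.1 hx hy hjx hjy hxy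
    have hA : ∀ y ∈ F, G.Adj j y → ∀ q ∈ F, ∀ q' ∈ F, ¬ G.Adj j q → ¬ G.Adj j q' → q ≠ q' →
        G.Adj y q → G.Adj y q' → G.Adj q q' := by
      intro y hy hjy q hq q' hq' hjq hjq' hne hyq hyq'
      by_contra h
      exact hfork y q q' j o hyq hyq' hjy.symm hoj.symm h (fun h => hjq h.symm)
        (fun h => hjq' h.symm) (fun h => ho.2 y hy h.symm) (fun h => ho.2 q hq h.symm)
        (fun h => ho.2 q' hq' h.symm) hne
    have hB : ∀ y ∈ F, G.Adj j y → ∀ q ∈ F, ∀ q' ∈ F, ¬ G.Adj j q → ¬ G.Adj j q' → q ≠ q' →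
        ¬ G.Adj y q → ¬ G.Adj y q' → G.Adj q q' := by
      intro y hy hjy q hq q' hq' hjq hjq' hne hyq hyq'
      by_contra h
      exact hfork w q q' y j (hw q hq) (hw q' hq') (hw y hy) hjy.symm h (fun h => hyq h.symm)
        (fun h => hyq' h.symm) hwj (fun h => hjq h.symm) (fun h => hjq' h.symm) hne
    obtain ⟨y, hy, hjy⟩ := hj.exists_adj
    obtain ⟨A, B, hAc, hBc, hAB⟩ : ∃ A B : Set V, G.IsClique A ∧ G.IsClique B ∧ F ⊆ A ∪ B := by
      by_cases hyq : G.Adj y q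
      · exact exists_isClique_cover h5 hN hA hB hq' hq hjq' hjq hqq'.symm (fun h => hqq h.symm)
          hy hjy fun h => hqq (hA y hy hjy q hq q' hq' hjq hjq' hqq' hyq h)
      · exact exists_isClique_cover h5 hN hA hB hq hq' hjq hjq' hqq' hqq hy hjy hyq
    exact hF.not_subset_union hAc hBc hAB
  set X : Set V := {x | x ∈ F ∨ IsMixedOn G F x ∨ (IsAntiTo G F x ∧
    ∀ p o, IsCompleteTo G F p → IsAntiTo G F o → G.Adj p o → G.Adj p x)} with hX
  have hcl := hhom X (by
    intro z hz
    have hzF : z ∉ F := fun h => hz (Or.inl h)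
    by_cases hzA : IsAntiTo G F z
    · right
      obtain ⟨p', o', hp', ho', hpo', hpz⟩ : ∃ p o, IsCompleteTo G F p ∧ IsAntiTo G F o ∧
          G.Adj p o ∧ ¬ G.Adj p z := by
        by_contra! h
        exact hz (Or.inr (Or.inr ⟨hzA, h⟩))
      rintro x (hx | hx | hx) hzx
      · exact hzA.2 x hx hzx
      · exact hpz (adj_isAntiTo_of_adj_isMixedOn hfork hF hzA hx hzx hp' ho' hpo')
      · exact hpz (adj_of_adj_isAntiTo_isAntiTo hfork hF hx.1 hzA hp'
          (hx.2 p' o' hp' ho' hpo') hzx.symm)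
    · left
      have hzC : IsCompleteTo G F z := by
        by_contra h
        exact hz (Or.inr (Or.inl ⟨hzF, h, hzA⟩))
      obtain ⟨o', ho', hzo'⟩ := hP₀ z hzC
      rintro x (hx | hx | hx)
      · exact hzC x hx
      · exact adj_isMixedOn hfork hF ho' hzC hzo' hx
      · exact hx.2 z o' hzC ho' hzo') (fun he => by
    have : p ∈ X := he ▸ Set.mem_univ p
    rcases this with h | h | h
    · exact hp.notMem h
    · exact h.2.1 hp
    · exact hF.not_isAntiTo_of_isCompleteTo hp h.1)
  exact hF.not_isClique (hcl.subset fun x hx => Or.inl hx)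

end Structure

section Bound

/-- The triangular number `m (m + 1) / 2`. -/
def triangular (m : ℕ) : ℕ := m * (m + 1) / 2

theorem triangular_succ (m : ℕ) : triangular (m + 1) = triangular m + (m + 1) := by
  unfold triangular
  rw [show (m + 1) * (m + 1 + 1) = m * (m + 1) + (m + 1) * 2 by ring,
    Nat.add_mul_div_right _ _ (by norm_num)]

theorem triangular_add_le (a b : ℕ) : triangular a + triangular b ≤ triangular (a + b) := by
  induction b with
  | zero => simp [triangular]
  | succ b ih =>
    rw [← add_assoc, triangular_succ, triangular_succ]
    omega

theorem triangular_mono : Monotone triangular :=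
  monotone_nat_of_le_succ fun m => by
    rw [triangular_succ]
    omega

theorem triangular_add_le_of_lt {a m : ℕ} (h : a < m) : triangular a + m ≤ triangular m := by
  obtain ⟨k, rfl⟩ : ∃ k, m = k + 1 := ⟨m - 1, by omega⟩
  rw [triangular_succ]
  have := triangular_mono (Nat.le_of_lt_succ h)
  omega

variable {V : Type*} {G : SimpleGraph V}

open Classical in
theorem card_lt_triangular (m : ℕ) (S : Finset V)
    (hS : ∀ a ∈ S, ∀ b ∈ S, ∀ d ∈ S, a ≠ b → a ≠ d → b ≠ d → ¬ G.Adj a b → ¬ G.Adj a d →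
      ¬ G.Adj b d → False) (hm : CliqueBoundOn G S m) : S.card < triangular (m + 1) := by
  induction m generalizing S with
  | zero =>
    have : S.card = 0 := by
      by_contra h
      obtain ⟨x, hx⟩ := Finset.card_pos.1 (Nat.pos_of_ne_zero h)
      have := hm {x} (by simpa using hx) (by simp)
      simp at this
    rw [this]
    decide
  | succ m ih =>
    rw [triangular_succ]
    by_cases h : S = ∅
    · simp [h]
    obtain ⟨x, hx⟩ := Finset.nonempty_iff_ne_empty.2 h
    set A := S.filter fun y => G.Adj x y with hA
    set B := S.filter fun y => y ≠ x ∧ ¬ G.Adj x y with hB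
    have hAm : ∀ y ∈ A, y ∈ S ∧ G.Adj x y := fun y hy => Finset.mem_filter.1 hy
    have hBm : ∀ y ∈ B, y ∈ S ∧ y ≠ x ∧ ¬ G.Adj x y := fun y hy => Finset.mem_filter.1 hy
    have h1 : A.card < triangular (m + 1) := by
      refine ih A (fun a ha b hb d hd => hS a (hAm a ha).1 b (hAm b hb).1 d (hAm d hd).1) ?_
      intro K hK hKc
      have hKx : ∀ y ∈ K, y ∈ S ∧ G.Adj x y := fun y hy => hAm y (hK hy)
      have := hm (insert x K) (by
        intro y hy
        rcases Finset.mem_insert.1 (Finset.mem_coe.1 hy) with rfl | hy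
        · exact hx
        · exact (hKx y hy).1) (by
        rw [Finset.coe_insert]
        exact hKc.insert fun y hy _ => (hKx y hy).2)
      rw [Finset.card_insert_of_notMem fun h => (hKx x h).2.ne rfl] at this
      omega
    have h2 : B.card ≤ m + 1 := by
      refine hm B (fun y hy => (hBm y hy).1) fun y hy z hz hyz => ?_
      by_contra hnot
      have hy' := hBm y hy
      have hz' := hBm z hz
      exact hS x hx y hy'.1 z hz'.1 hy'.2.1.symm hz'.2.1.symm hyz hy'.2.2 hz'.2.2 hnot
    have h3 : S ⊆ insert x (A ∪ B) := by
      intro y hy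
      simp only [hA, hB, Finset.mem_insert, Finset.mem_union, Finset.mem_filter]
      tauto
    have h4 := Finset.card_le_card h3
    have h5 := Finset.card_insert_le x (A ∪ B)
    have h6 := Finset.card_union_le A B
    omega

open Classical in
/-- A set is colourable as soon as all its connected components are. -/
theorem colourableOn_of_components {S : Set V} {n : ℕ}
    (h : ∀ o ∈ S, ColourableOn G {t | Relation.ReflTransGen (fun s t => t ∈ S ∧ G.Adj s t) o t} n) :
    ColourableOn G S n := by
  set C : V → Set V := fun o => {t | Relation.ReflTransGen (fun s t => t ∈ S ∧ G.Adj s t) o t}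
    with hC
  have hex : ∀ X : Set V, ∃ c : V → ℕ, ColourableOn G X n →
      (∀ x ∈ X, c x < n) ∧ ∀ x ∈ X, ∀ y ∈ X, G.Adj x y → c x ≠ c y := by
    intro X
    by_cases hX : ColourableOn G X n
    · obtain ⟨c, hc⟩ := hX
      exact ⟨c, fun _ => hc⟩
    · exact ⟨fun _ => 0, fun h => absurd h hX⟩
  choose col hcol using hex
  refine ⟨fun x => col (C x) x, fun x hx => (hcol _ (h x hx)).1 x Relation.ReflTransGen.refl, ?_⟩
  intro x hx y hy hxy
  have hle : ∀ x ∈ S, ∀ y ∈ S, G.Adj x y → C y ⊆ C x := fun x hx y hy hxy t ht =>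
    Relation.ReflTransGen.head ⟨hy, hxy⟩ ht
  have heq : C x = C y := (hle y hy x hx hxy.symm).antisymm (hle x hx y hy hxy)
  show col (C x) x ≠ col (C y) y
  rw [heq]
  exact (hcol _ (h y hy)).2 x
    (show x ∈ C y from heq.subset (Relation.ReflTransGen.refl : x ∈ C x)) y
    Relation.ReflTransGen.refl hxy

/-- The least number of colours needed for `S`. -/
noncomputable def chromaticNumberOn (G : SimpleGraph V) (S : Set V) : ℕ :=
  sInf {n | ColourableOn G S n}

variable [Fintype V]

theorem colourableOn_chromaticNumberOn (G : SimpleGraph V) (S : Set V) :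
    ColourableOn G S (chromaticNumberOn G S) :=
  Nat.sInf_mem (s := {n | ColourableOn G S n})
    ⟨_, (colourableOn_card (G := G) Finset.univ).mono (by simp) le_rfl⟩

open Classical in
theorem colourableOn_of_isClique {S : Set V} {m : ℕ} (hS : G.IsClique S)
    (hm : CliqueBoundOn G S m) : ColourableOn G S m := by
  have h : ((Finset.univ.filter fun x => x ∈ S : Finset V) : Set V) = S := by
    ext x
    simp
  have h1 := hm (Finset.univ.filter fun x => x ∈ S) h.le (by rwa [h])
  exact (colourableOn_card (G := G) (Finset.univ.filter fun x => x ∈ S)).mono h.ge h1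

open Classical in
theorem isClique_of_isHomogeneous (hfork : NoForkExtension G)
    (ih : ∀ S : Set V, S ≠ Set.univ → ∀ k, CliqueBoundOn G S k → ColourableOn G S (triangular k))
    {m : ℕ} (hm : CliqueBoundOn G Set.univ m) (hnot : ¬ ColourableOn G Set.univ (triangular m))
    (X : Set V) (hX : IsHomogeneous G X) (hXu : X ≠ Set.univ) : G.IsClique X := by
  by_contra hcl
  obtain ⟨Y, ⟨hY, hYu, hYc⟩, hmax⟩ := Set.exists_max_image
    {X : Set V | IsHomogeneous G X ∧ X ≠ Set.univ ∧ ¬ G.IsClique X} (chromaticNumberOn G)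
    (Set.toFinite _) ⟨X, hX, hXu, hcl⟩
  obtain ⟨x₁, hx₁, x₂, hx₂, hne, hx⟩ : ∃ x ∈ Y, ∃ y ∈ Y, x ≠ y ∧ ¬ G.Adj x y := by
    by_contra! h
    exact hYc fun x hx y hy hxy => h x hx y hy hxy
  set P : Set V := {z | z ∉ Y ∧ ∀ x ∈ Y, G.Adj z x} with hP
  set O : Set V := {z | z ∉ Y ∧ ∀ x ∈ Y, ¬ G.Adj z x} with hO
  obtain ⟨K, hKP, hK, hKm⟩ := exists_max_clique G P
  obtain ⟨L, hLY, hL, hLm⟩ := exists_max_clique G Y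
  have hsum : K.card + L.card ≤ m := by
    have hd : Disjoint K L := Finset.disjoint_left.2 fun z h1 h2 => (hKP h1).1 (hLY h2)
    rw [← Finset.card_union_of_disjoint hd]
    refine hm _ (Set.subset_univ _) ?_
    intro y hy z hz hyz
    rcases Finset.mem_union.1 (Finset.mem_coe.1 hy) with hy | hy <;>
      rcases Finset.mem_union.1 (Finset.mem_coe.1 hz) with hz | hz
    · exact hK hy hz hyz
    · exact (hKP hy).2 z (hLY hz)
    · exact ((hKP hz).2 y (hLY hy)).symm
    · exact hL hy hz hyz
  have hLpos : 1 ≤ L.card := by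
    simpa using hLm {x₁} (by simpa using hx₁) (by simp)
  have hPcol := ih P (fun he => by
    have : x₁ ∈ P := he ▸ Set.mem_univ x₁
    exact this.1 hx₁) _ hKm
  have hYle : chromaticNumberOn G Y ≤ triangular L.card := Nat.sInf_le (ih Y hYu _ hLm)
  set N := max (chromaticNumberOn G Y) m with hN
  have hOcol : ColourableOn G O N := by
    refine colourableOn_of_components fun o ho => ?_
    set C : Set V := {t | Relation.ReflTransGen (fun s t => t ∈ O ∧ G.Adj s t) o t} with hC
    have hCO : ∀ t ∈ C, t ∈ O := by
      intro t ht
      rcases Relation.ReflTransGen.cases_tail ht with h | ⟨s, -, h⟩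
      · rw [h]
        exact ho
      · exact h.1
    have hCu : C ≠ Set.univ := fun he => (hCO x₁ (he ▸ Set.mem_univ x₁)).1 hx₁
    have hChom : IsHomogeneous G C := by
      intro z hz
      by_cases hzY : z ∈ Y
      · exact Or.inr fun t ht h => (hCO t ht).2 z hzY h.symm
      rcases hY z hzY with hzP | hzO
      · have key : ∀ t ∈ C, (G.Adj z t ↔ G.Adj z o) := by
          intro t ht
          induction ht with
          | refl => rfl
          | @tail s t hs hst ih =>
            rw [← ih]
            have hsO := (hCO s hs).2
            have htO := hst.1.2
            constructor
            · intro h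
              by_contra h'
              exact hfork z x₁ x₂ t s (hzP x₁ hx₁) (hzP x₂ hx₂) h hst.2.symm hx
                (fun h => htO x₁ hx₁ h.symm) (fun h => htO x₂ hx₂ h.symm) h'
                (fun h => hsO x₁ hx₁ h.symm) (fun h => hsO x₂ hx₂ h.symm) hne
            · intro h
              by_contra h'
              exact hfork z x₁ x₂ s t (hzP x₁ hx₁) (hzP x₂ hx₂) h hst.2 hx
                (fun h => hsO x₁ hx₁ h.symm) (fun h => hsO x₂ hx₂ h.symm) h'
                (fun h => htO x₁ hx₁ h.symm) (fun h => htO x₂ hx₂ h.symm) hne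
        by_cases hzo : G.Adj z o
        · exact Or.inl fun t ht => (key t ht).2 hzo
        · exact Or.inr fun t ht h => hzo ((key t ht).1 h)
      · exact Or.inr fun t ht h =>
          hz (Relation.ReflTransGen.tail ht ⟨⟨hzY, hzO⟩, h.symm⟩)
    by_cases hCc : G.IsClique C
    · exact (colourableOn_of_isClique hCc (hm.mono (Set.subset_univ _) le_rfl)).mono le_rfl
        (le_max_right _ _)
    · exact (colourableOn_chromaticNumberOn G C).mono le_rfl
        ((hmax C ⟨hChom, hCu, hCc⟩).trans (le_max_left _ _))
  have hYO := ((colourableOn_chromaticNumberOn G Y).mono le_rfl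
    (le_max_left _ m)).union_of_not_adj hOcol fun x hx y hy h => hy.2 x hx h.symm
  refine hnot ((hPcol.union_add hYO).mono ?_ ?_)
  · intro z _
    by_cases hzY : z ∈ Y
    · exact Or.inr (Or.inl hzY)
    rcases hY z hzY with h | h
    · exact Or.inl ⟨hzY, h⟩
    · exact Or.inr (Or.inr ⟨hzY, h⟩)
  · have h1 := triangular_add_le K.card L.card
    have h2 := triangular_mono hsum
    have h3 := triangular_add_le_of_lt (show K.card < m by omega)
    rcases max_choice (chromaticNumberOn G Y) m with h | h <;> omega

open Classical in
theorem colourableOn_univ_of_forall_ne_univ (hfork : NoForkExtension G)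
    (hpara : ∀ F p o, IsCompleteTo G F p → IsAntiTo G F o → G.Adj p o → NoFiveHoleOn G F)
    (ih : ∀ S : Set V, S ≠ Set.univ → ∀ k, CliqueBoundOn G S k → ColourableOn G S (triangular k))
    {m : ℕ} (hm : CliqueBoundOn G Set.univ m) : ColourableOn G Set.univ (triangular m) := by
  by_contra hnot
  by_cases hV : Nonempty V
  swap
  · exact hnot ⟨fun _ => 0, fun x _ => absurd ⟨x⟩ hV, fun x _ => absurd ⟨x⟩ hV⟩
  obtain ⟨v⟩ := hV
  obtain ⟨k, rfl⟩ : ∃ k, m = k + 1 := by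
    have := hm {v} (Set.subset_univ _) (by simp)
    rw [Finset.card_singleton] at this
    exact ⟨m - 1, by omega⟩
  have hnbr : ∀ v, CliqueBoundOn G {x | G.Adj v x} k := by
    intro v K hK hKc
    have := hm (insert v K) (Set.subset_univ _) (by
      rw [Finset.coe_insert]
      exact hKc.insert fun y hy _ => hK hy)
    rw [Finset.card_insert_of_notMem fun h => (show G.Adj v v from hK h).ne rfl] at this
    omega
  have htri : ∀ v, ∃ a b d, G.Adj v a ∧ G.Adj v b ∧ G.Adj v d ∧ a ≠ b ∧ a ≠ d ∧ b ≠ d ∧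
      ¬ G.Adj a b ∧ ¬ G.Adj a d ∧ ¬ G.Adj b d := by
    intro v
    by_contra! hcon
    have hcol := ih {v}ᶜ (by simp) (k + 1) (hm.mono (Set.subset_univ _) le_rfl)
    refine hnot ((hcol.insert_of_card_lt (r := v) ?_).mono ?_ le_rfl)
    · refine card_lt_triangular (G := G) k _ ?_ ?_
      · intro a ha b hb d hd h1 h2 h3 h4 h5 h6
        simp only [Finset.mem_filter, Finset.mem_univ, true_and] at ha hb hd
        exact h6 (hcon a b d ha.2 hb.2 hd.2 h1 h2 h3 h4 h5)
      · refine (hnbr v).mono ?_ le_rfl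
        intro x hx
        have hx' := Finset.mem_coe.1 hx
        simp only [Finset.mem_filter, Finset.mem_univ, true_and] at hx'
        exact hx'.2
    · intro x _
      by_cases h : x = v
      · exact Or.inl h
      · exact Or.inr h
  set M : Set V := {x | x ≠ v ∧ ¬ G.Adj v x} with hM
  have hMcol : ¬ ColourableOn G M (k + 1) := by
    intro h
    have h1 := h.union_of_not_adj ((colourableOn_singleton (G := G) v).mono le_rfl
      (by omega : 1 ≤ k + 1)) (by
        rintro x hx y rfl hxy
        exact hx.2 hxy.symm)
    have h2 := ih {x | G.Adj v x} (fun he => by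
      have : v ∈ {x | G.Adj v x} := he ▸ Set.mem_univ v
      exact (show G.Adj v v from this).ne rfl) k (hnbr v)
    refine hnot ((h2.union_add h1).mono ?_ (triangular_succ k).ge)
    intro x _
    by_cases h3 : G.Adj v x
    · exact Or.inl h3
    by_cases h4 : x = v
    · exact Or.inr (Or.inr h4)
    · exact Or.inr (Or.inl ⟨h4, h3⟩)
  obtain ⟨F, hFM, hF⟩ := exists_isMinimallyImperfect_subset
    (hm.mono (Set.subset_univ M) le_rfl) hMcol
  exact hF.not_isAntiTo hfork (hpara F)
    (fun X => isClique_of_isHomogeneous hfork ih hm hnot X) htri v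
    ⟨fun h => (hFM h).1 rfl, fun f hf => (hFM hf).2⟩

open Classical in
theorem colourableOn_univ_triangular (n : ℕ) {V : Type*} [Fintype V] (G : SimpleGraph V)
    (hn : Fintype.card V = n) (hfork : NoForkExtension G)
    (hpara : ∀ F p o, IsCompleteTo G F p → IsAntiTo G F o → G.Adj p o → NoFiveHoleOn G F)
    (m : ℕ) (hm : CliqueBoundOn G Set.univ m) : ColourableOn G Set.univ (triangular m) := by
  induction n using Nat.strong_induction_on generalizing V m with
  | _ n ih =>
  refine colourableOn_univ_of_forall_ne_univ hfork hpara (fun S hS k hk => ?_) hm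
  obtain ⟨w, hw⟩ := (Set.ne_univ_iff_exists_notMem S).1 hS
  have hcol := ih (Fintype.card S) (hn ▸ Fintype.card_subtype_lt hw) (G.induce S) rfl ?_ ?_ k ?_
  · obtain ⟨c, h1, h2⟩ := hcol
    refine ⟨fun x => if h : x ∈ S then c ⟨x, h⟩ else 0, ?_, ?_⟩
    · intro x hx
      simpa [hx] using h1 ⟨x, hx⟩ (Set.mem_univ _)
    · intro x hx y hy hxy
      simpa [hx, hy] using h2 ⟨x, hx⟩ (Set.mem_univ _) ⟨y, hy⟩ (Set.mem_univ _) hxy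
  · intro c a b d e h1 h2 h3 h4 h5 h6 h7 h8 h9 h10 h11
    exact hfork c a b d e h1 h2 h3 h4 h5 h6 h7 h8 h9 h10 fun h => h11 (Subtype.ext h)
  · intro F p o hp ho hpo a ha b hb c hc d hd e he
    refine hpara (Subtype.val '' F) p o ?_ ⟨?_, ?_⟩ hpo a ⟨a, ha, rfl⟩ b ⟨b, hb, rfl⟩
      c ⟨c, hc, rfl⟩ d ⟨d, hd, rfl⟩ e ⟨e, he, rfl⟩
    · rintro _ ⟨f, hf, rfl⟩
      exact hp f hf
    · rintro ⟨f, hf, hfo⟩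
      exact ho.1 (Subtype.ext hfo ▸ hf)
    · rintro _ ⟨f, hf, rfl⟩
      exact ho.2 f hf
  · intro K _ hK
    have := hk (K.map (Function.Embedding.subtype _)) (by
      intro x hx
      obtain ⟨y, -, rfl⟩ := Finset.mem_map.1 (Finset.mem_coe.1 hx)
      exact y.2) (by
      intro x hx y hy hxy
      obtain ⟨x, hx', rfl⟩ := Finset.mem_map.1 (Finset.mem_coe.1 hx)
      obtain ⟨y, hy', rfl⟩ := Finset.mem_map.1 (Finset.mem_coe.1 hy)
      exact hK hx' hy' fun h => hxy (h ▸ rfl))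
    rwa [Finset.card_map] at this

end Bound

section Patterns

variable {V : Type*} {G : SimpleGraph V}

instance : DecidableRel fork.Adj := by
  unfold fork
  infer_instance

theorem oddParachute_five_adj (a b : Fin 5 ⊕ Fin 2) : (oddParachute 5).Adj a b ↔
    a ≠ b ∧ (((∃ i : Fin 5, a = Sum.inl i ∧ b = Sum.inl (i + 1)) ∨
    (∃ i : Fin 5, a = Sum.inl i ∧ b = Sum.inr 0) ∨ (a = Sum.inr 0 ∧ b = Sum.inr 1)) ∨
    ((∃ i : Fin 5, b = Sum.inl i ∧ a = Sum.inl (i + 1)) ∨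
    (∃ i : Fin 5, b = Sum.inl i ∧ a = Sum.inr 0) ∨ (b = Sum.inr 0 ∧ a = Sum.inr 1))) :=
  Iff.rfl

theorem ForkFree.noForkExtension (h : ForkFree G) : NoForkExtension G := by
  intro c a b d e ca cb cd de ab ad bd ce ae be hab
  have hf : ∀ i j : Fin 5, G.Adj (![a, b, c, d, e] i) (![a, b, c, d, e] j) ↔ fork.Adj i j := by
    have key : ∀ {x y}, ¬ G.Adj x y → ¬ G.Adj y x := fun h h' => h h'.symm
    have h1 := ca.symm
    have h2 := cb.symm
    have h3 := cd.symm
    have h4 := de.symm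
    have h5 := key ab
    have h6 := key ad
    have h7 := key bd
    have h8 := key ce
    have h9 := key ae
    have h10 := key be
    intro i j
    fin_cases i <;> fin_cases j <;>
    first
      | exact iff_of_false (G.irrefl) (by decide)
      | exact iff_of_true (by assumption) (by decide)
      | exact iff_of_false (by assumption) (by decide)
  refine h.false ⟨⟨![a, b, c, d, e], ?_⟩, hf _ _⟩
  have hac := ca.ne
  have hbc := cb.ne
  have hcd := cd.ne
  have hde := de.ne
  have had : a ≠ d := fun h => ae (h ▸ de)
  have hbd : b ≠ d := fun h => be (h ▸ de)
  have hae : a ≠ e := fun h => ce (h ▸ ca)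
  have hbe : b ≠ e := fun h => ce (h ▸ cb)
  have hce : c ≠ e := fun h => ae (h ▸ ca.symm)
  intro i j hij
  fin_cases i <;> fin_cases j <;> first | rfl | exact absurd hij (by assumption) | exact absurd hij.symm (by assumption)

theorem OddParachuteFree.noFiveHoleOn (h : OddParachuteFree G) (F : Set V) (p o : V)
    (hp : IsCompleteTo G F p) (ho : IsAntiTo G F o) (hpo : G.Adj p o) : NoFiveHoleOn G F := by
  intro a ha b hb c hc d hd e he ab bc cd de ea ac ad bd be ce
  have hf : ∀ i j : Fin 5 ⊕ Fin 2, G.Adj (Sum.elim ![a, b, c, d, e] ![p, o] i)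
      (Sum.elim ![a, b, c, d, e] ![p, o] j) ↔ (oddParachute 5).Adj i j := by
    have pa := hp a ha
    have pb := hp b hb
    have pc := hp c hc
    have pd := hp d hd
    have pe := hp e he
    have oa := ho.2 a ha
    have ob := ho.2 b hb
    have oc := ho.2 c hc
    have od := ho.2 d hd
    have oe := ho.2 e he
    have key : ∀ {x y}, ¬ G.Adj x y → ¬ G.Adj y x := fun h h' => h h'.symm
    intro i j
    rw [oddParachute_five_adj]
    revert i j
    rintro (i | i) (j | j) <;> fin_cases i <;> fin_cases j <;>
    first
      | exact iff_of_false (G.irrefl) (by decide)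
      | exact iff_of_true (by assumption) (by decide)
      | exact iff_of_true (SimpleGraph.Adj.symm (by assumption)) (by decide)
      | exact iff_of_false (by assumption) (by decide)
      | exact iff_of_false (key (by assumption)) (by decide)
  refine (h 5 le_rfl (by decide)).false ⟨⟨Sum.elim ![a, b, c, d, e] ![p, o], ?_⟩, hf _ _⟩
  have hab := ab.ne
  have hbc := bc.ne
  have hcd := cd.ne
  have hde := de.ne
  have hea := ea.ne
  have hac : a ≠ c := fun h => ad (h ▸ cd)
  have had : a ≠ d := fun h => ac (h ▸ cd.symm)
  have hbd : b ≠ d := fun h => be (h ▸ de)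
  have hbe : b ≠ e := fun h => bd (h ▸ de.symm)
  have hce : c ≠ e := fun h => ac (h ▸ ea.symm)
  have hpo' := hpo.ne
  have hpF : ∀ x ∈ F, x ≠ p := fun x hx h => hp.notMem (h ▸ hx)
  have hoF : ∀ x ∈ F, x ≠ o := fun x hx h => ho.1 (h ▸ hx)
  have pa := hpF a ha
  have pb := hpF b hb
  have pc := hpF c hc
  have pd := hpF d hd
  have pe := hpF e he
  have oa := hoF a ha
  have ob := hoF b hb
  have oc := hoF c hc
  have od := hoF d hd
  have oe := hoF e he
  show ∀ i j : Fin 5 ⊕ Fin 2, _ → i = j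
  rintro (i | i) (j | j) hij <;> fin_cases i <;> fin_cases j <;>
  first
    | rfl
    | exact absurd hij (by assumption)
    | exact absurd hij.symm (by assumption)

theorem cliqueBoundOn_cliqueNumber [Fintype V] (G : SimpleGraph V) :
    CliqueBoundOn G Set.univ (cliqueNumber G) := by
  intro K _ hK
  refine le_csSup ⟨Fintype.card V, ?_⟩ ⟨K, hK, rfl⟩
  rintro n ⟨s, hs⟩
  exact hs.card_eq ▸ Finset.card_le_univ s

theorem ColourableOn.colorable {n : ℕ} (h : ColourableOn G Set.univ n) : G.Colorable n := by
  obtain ⟨c, h1, h2⟩ := h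
  exact ⟨SimpleGraph.Coloring.mk (fun x => (⟨c x, h1 x (Set.mem_univ x)⟩ : Fin n))
    fun {x y} hxy heq => h2 x (Set.mem_univ x) y (Set.mem_univ y) hxy (Fin.mk.inj heq)⟩

end Patterns

/-- Every (fork, odd parachute)-free graph G satisfies χ(G) ≤ ω(G)(ω(G)+1)/2. -/
theorem stmt_8 {V : Type*} [Fintype V] (G : SimpleGraph V)
    (hfork : ForkFree G) (hpara : OddParachuteFree G) :
    G.chromaticNumber ≤ ((cliqueNumber G * (cliqueNumber G + 1) / 2 : ℕ) : ℕ∞) :=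
  (colourableOn_univ_triangular _ G rfl hfork.noForkExtension hpara.noFiveHoleOn _
    (cliqueBoundOn_cliqueNumber G)).colorable.chromaticNumber_le
end

section
/- Let G be a nonperfectly divisible fork-free graph with ω(G) ≤ 3. Then G has a trisimplicial vertex. -/
open SimpleGraph

section ForkFreeStructure

variable {V : Type*} {G : SimpleGraph V}

/-- Two leaves `x`, `y` of `w` and an induced path `w, p, q` cannot coexist in a fork-free graph. -/
theorem ForkFree.elim (hf : ForkFree G) {w x y p q : V}
    (wx : G.Adj w x) (wy : G.Adj w y) (wp : G.Adj w p) (pq : G.Adj p q)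
    (hxy : x ≠ y) (xy : ¬ G.Adj x y) (xp : ¬ G.Adj x p) (yp : ¬ G.Adj y p)
    (wq : ¬ G.Adj w q) (xq : ¬ G.Adj x q) (yq : ¬ G.Adj y q) : False := by
  have h1 : x ≠ w := wx.ne'
  have h2 : y ≠ w := wy.ne'
  have h3 : p ≠ w := wp.ne'
  have h4 : p ≠ q := pq.ne
  have h5 : x ≠ p := by rintro rfl; exact xq pq
  have h6 : y ≠ p := by rintro rfl; exact yq pq
  have h7 : w ≠ q := by rintro rfl; exact xq wx.symm
  have h8 : x ≠ q := by rintro rfl; exact wq wx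
  have h9 : y ≠ q := by rintro rfl; exact wq wy
  refine hf.false ⟨⟨![x, y, w, p, q], ?_⟩, ?_⟩
  · intro a b hab
    fin_cases a <;> fin_cases b <;> simp_all
  · intro a b
    change G.Adj (![x, y, w, p, q] a) (![x, y, w, p, q] b) ↔ fork.Adj a b
    fin_cases a <;> fin_cases b <;> simp_all [fork, SimpleGraph.fromRel_adj, G.adj_comm]

theorem ForkFree.induce (hf : ForkFree G) (S : Set V) : ForkFree (G.induce S) :=
  ⟨fun e => hf.false (e.trans (SimpleGraph.Embedding.induce S))⟩

/-- `c` runs periodically through an odd hole of length `n` in `G`. -/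
structure OddHole (G : SimpleGraph V) (n : ℤ) (c : ℤ → V) : Prop where
  odd : Odd n
  five_le : 5 ≤ n
  periodic : ∀ i, c (i + n) = c i
  adj : ∀ i, G.Adj (c i) (c (i + 1))
  not_adj : ∀ i m, 2 ≤ m → m ≤ n - 2 → ¬ G.Adj (c i) (c (i + m))

namespace OddHole

variable {n : ℤ} {c : ℤ → V}

theorem adj' (h : OddHole G n c) {i j : ℤ} (hij : j = i + 1) : G.Adj (c i) (c j) :=
  hij ▸ h.adj i

theorem not_adj' (h : OddHole G n c) {i j : ℤ} (h2 : i + 2 ≤ j) (hn : j ≤ i + n - 2) :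
    ¬ G.Adj (c i) (c j) := by
  have := h.not_adj i (j - i) (by omega) (by omega)
  rwa [add_sub_cancel] at this

theorem ne (h : OddHole G n c) {i j : ℤ} (h1 : i + 1 ≤ j) (hn : j ≤ i + n - 1) : c i ≠ c j := by
  intro he
  have h5 := h.five_le
  rcases le_or_gt j (i + n - 3) with hj | hj
  · rcases eq_or_lt_of_le h1 with rfl | h2
    · exact (h.adj i).ne he
    · have := h.adj' (i := i - 1) (j := i) (by omega)
      rw [he] at this
      exact h.not_adj' (by omega) (by omega) this
  · have := h.adj' (i := i) (j := i + 1) rfl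
    rw [he] at this
    rcases eq_or_lt_of_le hn with rfl | h2
    · have h3 := h.adj (i + n - 1)
      rw [show i + n - 1 + 1 = i + n by omega, h.periodic, he] at h3
      exact h3.ne rfl
    · exact h.not_adj' (by omega) (by omega) this.symm

theorem exists_shift_eq (h : OddHole G n c) (i j : ℤ) :
    ∃ m, 0 ≤ m ∧ m < n ∧ ∀ t, c (j + t) = c (i + m + t) := by
  have h5 := h.five_le
  refine ⟨(j - i) % n, Int.emod_nonneg _ (by omega), Int.emod_lt_of_pos _ (by omega), fun t => ?_⟩
  have hp : Function.Periodic c n := h.periodic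
  rw [← hp.sub_zsmul_eq ((j - i) / n) (x := j + t), Int.emod_def]
  congr 1
  simp only [zsmul_eq_mul, Int.cast_id]
  ring

theorem exists_eq_add (h : OddHole G n c) (i j : ℤ) : ∃ m, 0 ≤ m ∧ m < n ∧ c j = c (i + m) := by
  obtain ⟨m, h0, hm, he⟩ := h.exists_shift_eq i j
  exact ⟨m, h0, hm, by simpa using he 0⟩

theorem reverse (h : OddHole G n c) : OddHole G n (fun i => c (-i)) where
  odd := h.odd
  five_le := h.five_le
  periodic i := by
    have := h.periodic (-(i + n))
    rw [← this]; congr 1; ring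
  adj i := (h.adj' (by ring)).symm
  not_adj i m h2 hm ha := h.not_adj' (by omega) (by omega) ha.symm

/-- A set of indices of an odd hole closed under steps of two contains every index. -/
theorem forall_of_step_two (h : OddHole G n c) {P : V → Prop} {i : ℤ} (hi : P (c i))
    (step : ∀ j, P (c j) → P (c (j + 2))) (j : ℤ) : P (c j) := by
  have up : ∀ k : ℕ, ∀ i, P (c i) → P (c (i + 2 * k)) := by
    intro k
    induction k with
    | zero => intro i hi; simpa using hi
    | succ k ih =>
      intro i hi
      have := step _ (ih i hi)
      rwa [show i + 2 * (k : ℤ) + 2 = i + 2 * ((k + 1 : ℕ) : ℤ) by push_cast; ring] at this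
  obtain ⟨m, h0, hm, he⟩ := h.exists_eq_add i j
  rw [he]
  obtain ⟨r, hr⟩ := h.odd
  rcases Int.even_or_odd' m with ⟨k, hk | hk⟩
  · have := up k.toNat i hi
    rwa [show i + 2 * (k.toNat : ℤ) = i + m by omega] at this
  · have := up (k + r + 1).toNat i hi
    rwa [show i + 2 * ((k + r + 1).toNat : ℤ) = i + m + n by omega, h.periodic] at this

/-- In a fork-free graph a vertex with a neighbour on an odd hole has two consecutive ones. -/
theorem exists_consecutive (h : OddHole G n c) (hf : ForkFree G) {y : V} (hy : ∀ j, y ≠ c j)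
    {i : ℤ} (hi : G.Adj y (c i)) : ∃ j, G.Adj y (c j) ∧ G.Adj y (c (j + 1)) := by
  by_contra! hcon
  have h5 := h.five_le
  refine hcon i hi (h.forall_of_step_two (P := fun v => G.Adj y v) hi (fun j hj => ?_) _)
  by_contra hj2
  have hprev : ¬ G.Adj y (c (j - 1)) := fun hp => hcon _ hp (by rwa [sub_add_cancel])
  exact hf.elim (w := c j) (x := c (j - 1)) (y := y) (p := c (j + 1)) (q := c (j + 2))
    (h.adj' (by ring)).symm hj.symm (h.adj j) (h.adj' (by ring)) (hy _).symm
    (fun ha => hprev ha.symm) (h.not_adj' (by omega) (by omega)) (hcon j hj)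
    (h.not_adj' (by omega) (by omega)) (h.not_adj' (by omega) (by omega)) hj2

end OddHole

/-- A closed sequence of `p` consecutively adjacent vertices of `A`. -/
def HasClosedWalk (G : SimpleGraph V) (A : Set V) (p : ℤ) : Prop :=
  ∃ c : ℤ → V, (∀ i, c i ∈ A) ∧ (∀ i, c (i + p) = c i) ∧ ∀ i, G.Adj (c i) (c (i + 1))

theorem hasClosedWalk_of_path {A : Set V} {p : ℤ} (hp : 1 ≤ p) (d : ℤ → V)
    (hA : ∀ i, 0 ≤ i → i < p → d i ∈ A)
    (hadj : ∀ i, 0 ≤ i → i < p - 1 → G.Adj (d i) (d (i + 1)))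
    (hclose : G.Adj (d (p - 1)) (d 0)) : HasClosedWalk G A p := by
  refine ⟨fun i => d (i % p), fun i => hA _ (Int.emod_nonneg _ (by omega))
    (Int.emod_lt_of_pos _ (by omega)), fun i => by simp, fun i => ?_⟩
  have h0 := Int.emod_nonneg i (show p ≠ 0 by omega)
  have h1 := Int.emod_lt_of_pos i (show 0 < p by omega)
  have h2 : (i + 1) % p = (i % p + 1) % p := by simp
  beta_reduce
  rw [h2]
  rcases eq_or_ne (i % p) (p - 1) with h | h
  · rw [h, sub_add_cancel, Int.emod_self]; exact hclose
  · rw [Int.emod_eq_of_lt (a := i % p + 1) (by omega) (by omega)]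
    exact hadj _ h0 (by omega)

/-- A set spanning neither a triangle nor an odd hole is bipartite. -/
theorem exists_bicoloring {A : Set V}
    (htri : ∀ x ∈ A, ∀ y ∈ A, ∀ z ∈ A, G.Adj x y → G.Adj y z → G.Adj x z → False)
    (hhole : ∀ n c, OddHole G n c → (∀ i, c i ∈ A) → False) :
    (G.induce A).Colorable 2 := by
  classical
  rw [SimpleGraph.two_colorable_iff_forall_loop_even]
  intro u w
  by_contra hodd
  rw [Nat.not_even_iff_odd] at hodd
  have hex : ∃ n : ℕ, Odd n ∧ HasClosedWalk G A n := by
    refine ⟨w.length, hodd, ?_⟩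
    obtain ⟨r, hr⟩ := hodd
    refine hasClosedWalk_of_path (by omega) (fun i => (w.getVert i.toNat : V))
      (fun i _ _ => Subtype.prop _) (fun i h0 h1 => ?_) ?_
    · have := w.adj_getVert_succ (i := i.toNat) (by omega)
      rw [show (i + 1).toNat = i.toNat + 1 by omega]
      exact this
    · have := w.adj_getVert_succ (i := w.length - 1) (by omega)
      rw [show w.length - 1 + 1 = w.length by omega, w.getVert_length] at this
      rw [show ((w.length : ℤ) - 1).toNat = w.length - 1 by omega]
      simpa using this
  obtain ⟨hn, c, hcA, hper, hadj⟩ := Nat.find_spec hex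
  have hmin := fun m (hm : m < Nat.find hex) => Nat.find_min hex hm
  set n := Nat.find hex
  have hadj' : ∀ {i j : ℤ}, j = i + 1 → G.Adj (c i) (c j) := fun h => h ▸ hadj _
  obtain ⟨r, hr⟩ := hn
  have hchord : ∀ i m : ℤ, 2 ≤ m → m ≤ n - 2 → ¬ G.Adj (c i) (c (i + m)) := by
    intro i m h2 hm ha
    rcases Int.even_or_odd' m with ⟨k, hk | hk⟩
    · refine hmin (m + 1).toNat (by omega) ⟨⟨k.toNat, by omega⟩, ?_⟩
      refine hasClosedWalk_of_path (by omega) (fun j => c (i + j)) (fun _ _ _ => hcA _)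
        (fun j _ _ => hadj' (by ring)) ?_
      rw [show i + (((m + 1).toNat : ℤ) - 1) = i + m by omega, add_zero]
      exact ha.symm
    · refine hmin (n - m + 1).toNat (by omega) ⟨⟨(r - k).toNat, by omega⟩, ?_⟩
      refine hasClosedWalk_of_path (by omega) (fun j => c (i + m + j)) (fun _ _ _ => hcA _)
        (fun j _ _ => hadj' (by ring)) ?_
      rw [show i + m + (((n - m + 1).toNat : ℤ) - 1) = i + n by omega, add_zero, hper]
      exact ha
  rcases Nat.lt_or_ge n 5 with h5 | h5
  · have : n = 1 ∨ n = 3 := by omega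
    rcases this with h | h
    · have h1 := hadj 0
      have h2 := hper 0
      rw [h] at h2
      simp only [Nat.cast_one] at h2
      rw [h2] at h1
      exact h1.ne rfl
    · have h2 := hper 0
      have h3 := hadj 2
      rw [h] at h2
      norm_num at h2 h3
      rw [h2] at h3
      exact htri _ (hcA 0) _ (hcA 1) _ (hcA 2) (hadj 0) (hadj 1) h3.symm
  · exact hhole n c ⟨⟨r, by omega⟩, by omega, hper, hadj, hchord⟩ hcA

theorem not_k4 (hK : G.CliqueFree 4) {a b c d : V} (ab : G.Adj a b) (ac : G.Adj a c)
    (ad : G.Adj a d) (bc : G.Adj b c) (bd : G.Adj b d) (cd : G.Adj c d) : False := by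
  classical
  refine hK {a, b, c, d} ⟨?_, ?_⟩
  · rw [SimpleGraph.isClique_iff]
    intro x hx y hy hxy
    simp only [Finset.coe_insert, Finset.coe_singleton, Set.mem_insert_iff,
      Set.mem_singleton_iff] at hx hy
    rcases hx with rfl | rfl | rfl | rfl <;> rcases hy with rfl | rfl | rfl | rfl <;>
      first
        | exact absurd rfl hxy
        | assumption
        | (apply SimpleGraph.Adj.symm; assumption)
  · have := ab.ne; have := ac.ne; have := ad.ne; have := bc.ne; have := bd.ne; have := cd.ne
    simp [*]

namespace OddHole

variable {n : ℤ} {c : ℤ → V}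

theorem ne_of_forall_not_adj (h : OddHole G n c) {z : V} (hz : ∀ j, ¬ G.Adj z (c j)) (j : ℤ) :
    z ≠ c j := fun he => hz (j + 1) (he ▸ h.adj j)

theorem exists_consecutive_from (h : OddHole G n c) (hf : ForkFree G) {y : V}
    (hy : ∀ j, y ≠ c j) {i₀ : ℤ} (hi₀ : G.Adj y (c i₀)) (i : ℤ) :
    ∃ m, 0 ≤ m ∧ m < n ∧ G.Adj y (c (i + m)) ∧ G.Adj y (c (i + m + 1)) := by
  obtain ⟨j, hj, hj1⟩ := h.exists_consecutive hf hy hi₀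
  obtain ⟨m, h0, hm, he⟩ := h.exists_shift_eq i j
  exact ⟨m, h0, hm, by rwa [show c (i + m) = c j by simpa using (he 0).symm], he 1 ▸ hj1⟩

/-- A neighbour of an odd hole which also has a neighbour far from the hole is complete to the
hole or attaches to it along exactly one edge. -/
theorem complete_or_edge (h : OddHole G n c) (hf : ForkFree G) {w z : V} (hwz : G.Adj w z)
    (hz : ∀ j, ¬ G.Adj z (c j)) {i₀ : ℤ} (hi₀ : G.Adj w (c i₀)) :
    (∀ j, G.Adj w (c j)) ∨ ∃ i, G.Adj w (c i) ∧ G.Adj w (c (i + 1)) ∧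
      ∀ j, i + 2 ≤ j → j ≤ i + n - 1 → ¬ G.Adj w (c j) := by
  have h5 := h.five_le
  have hwc : ∀ j, w ≠ c j := fun j he => hz j (he ▸ hwz.symm)
  by_cases hall : ∀ j, G.Adj w (c j)
  · exact Or.inl hall
  right
  obtain ⟨i, hi, hi1⟩ : ∃ i, G.Adj w (c i) ∧ ¬ G.Adj w (c (i + 1)) := by
    by_contra! hcon
    apply hall
    exact h.forall_of_step_two (P := fun v => G.Adj w v) hi₀ fun j hj => by
      have := hcon _ (hcon j hj)
      rwa [add_assoc] at this
  have hfar : ∀ j, i + 3 ≤ j → j ≤ i + n - 2 → ¬ G.Adj w (c j) := fun j h3 hj ha =>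
    hf.elim hwz ha hi (h.adj i) (h.ne_of_forall_not_adj hz j) (hz j) (hz i)
      (fun ha => h.not_adj' (by omega) (by omega) ha.symm) hi1 (hz _)
      (fun ha => h.not_adj' (by omega) (by omega) ha.symm)
  have hprev : G.Adj w (c (i - 1)) := by
    obtain ⟨m, h0, hm, hj, hj1⟩ := h.exists_consecutive_from hf hwc hi i
    rcases eq_or_ne m (n - 1) with h1 | h1
    · rwa [h1, show i + (n - 1) = i - 1 + n by ring, h.periodic] at hj
    rcases eq_or_ne m 0 with h2 | h2
    · rw [h2, add_zero] at hj1; exact absurd hj1 hi1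
    rcases eq_or_ne m 1 with h3 | h3
    · rw [h3] at hj; exact absurd hj hi1
    rcases eq_or_ne m 2 with h4 | h4
    · exact absurd hj1 (hfar _ (by omega) (by omega))
    · exact absurd hj (hfar _ (by omega) (by omega))
  have hi2 : ¬ G.Adj w (c (i + 2)) := fun ha =>
    hf.elim hwz hprev ha (h.adj' (i := i + 1) (by ring)).symm (h.ne_of_forall_not_adj hz _)
      (hz _) (hz _) (h.not_adj' (by omega) (by omega)) hi1 (hz _)
      (h.not_adj' (by omega) (by omega))
  refine ⟨i - 1, hprev, by rwa [sub_add_cancel], fun j h2 hj => ?_⟩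
  rcases eq_or_ne j (i + 1) with rfl | h3
  · exact hi1
  rcases eq_or_ne j (i + 2) with rfl | h4
  · exact hi2
  exact hfar j (by omega) (by omega)

/-- Neighbours of an edge-attached vertex `w` which miss a far neighbour of `w` but touch the hole
are adjacent to the second end of the attachment edge. -/
theorem adj_succ_of_edge (h : OddHole G n c) (hf : ForkFree G) {w z y : V} {i : ℤ}
    (hb : G.Adj w (c (i + 1))) (hfar : ∀ j, i + 2 ≤ j → j ≤ i + n - 1 → ¬ G.Adj w (c j))
    (hwz : G.Adj w z) (hz : ∀ j, ¬ G.Adj z (c j)) (hwy : G.Adj w y) (hyz : ¬ G.Adj z y)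
    (hyc : ∀ j, y ≠ c j) {i₀ : ℤ} (hi₀ : G.Adj y (c i₀)) : G.Adj y (c (i + 1)) := by
  by_contra hyb
  have h5 := h.five_le
  have key : ∀ j, i + 3 ≤ j → j ≤ i + n - 1 → ¬ G.Adj y (c j) := fun j h3 hj ha =>
    hf.elim hwz hb hwy ha (h.ne_of_forall_not_adj hz _) (hz _) hyz (fun ha => hyb ha.symm)
      (hfar j (by omega) hj) (hz _) (h.not_adj' (by omega) (by omega))
  obtain ⟨m, h0, hm, hj, hj1⟩ := h.exists_consecutive_from hf hyc hi₀ i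
  rcases eq_or_ne m 0 with h1 | h1
  · rw [h1, add_zero] at hj1; exact hyb hj1
  rcases eq_or_ne m 1 with h2 | h2
  · rw [h2] at hj; exact hyb hj
  rcases eq_or_ne m (n - 1) with h3 | h3
  · exact key _ (by omega) (by omega) hj
  · exact key _ (by omega) (by omega) hj1

theorem edge_reverse (h : OddHole G n c) {w : V} {i : ℤ}
    (hfar : ∀ j, i + 2 ≤ j → j ≤ i + n - 1 → ¬ G.Adj w (c j)) :
    ∀ j, -(i + 1) + 2 ≤ j → j ≤ -(i + 1) + n - 1 → ¬ G.Adj w (c (-j)) := by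
  intro j h2 hj
  rw [← h.periodic]
  exact hfar _ (by omega) (by omega)

theorem adj_of_edge (h : OddHole G n c) (hf : ForkFree G) {w z y : V} {i : ℤ}
    (ha : G.Adj w (c i)) (hfar : ∀ j, i + 2 ≤ j → j ≤ i + n - 1 → ¬ G.Adj w (c j))
    (hwz : G.Adj w z) (hz : ∀ j, ¬ G.Adj z (c j)) (hwy : G.Adj w y) (hyz : ¬ G.Adj z y)
    (hyc : ∀ j, y ≠ c j) {i₀ : ℤ} (hi₀ : G.Adj y (c i₀)) : G.Adj y (c i) := by
  have := h.reverse.adj_succ_of_edge hf (w := w) (z := z) (y := y) (i := -(i + 1)) (i₀ := -i₀)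
    (by simpa using ha) (h.edge_reverse hfar) hwz (fun j => hz _) hwy hyz (fun j => hyc _)
    (by simpa using hi₀)
  simpa using this

end OddHole

theorem trisimplicial_of_no_three {w a b z : V} (hwa : G.Adj w a) (hwb : G.Adj w b)
    (hwz : G.Adj w z) (hab : G.Adj a b)
    (hz : ∀ d, G.Adj w d → d ≠ a → d ≠ b → d ≠ z → G.Adj z d)
    (h3 : ∀ d₁ d₂ d₃, G.Adj w d₁ → G.Adj w d₂ → G.Adj w d₃ → G.Adj z d₁ → G.Adj z d₂ →
      G.Adj z d₃ → d₁ ≠ a → d₁ ≠ b → d₂ ≠ a → d₂ ≠ b → d₃ ≠ a → d₃ ≠ b →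
      d₁ ≠ d₂ → d₁ ≠ d₃ → d₂ ≠ d₃ → False) : Trisimplicial G w := by
  have key : ∃ d₁ d₂, (d₁ = z ∨ G.Adj z d₁) ∧ G.Adj w d₁ ∧ G.Adj w d₂ ∧
      ∀ d, G.Adj w d → d = a ∨ d = b ∨ d = z ∨ d = d₁ ∨ d = d₂ := by
    by_cases h0 : ∃ d₁, G.Adj w d₁ ∧ d₁ ≠ a ∧ d₁ ≠ b ∧ d₁ ≠ z
    · obtain ⟨d₁, hw1, ha1, hb1, hz1⟩ := h0
      by_cases h1 : ∃ d₂, G.Adj w d₂ ∧ d₂ ≠ a ∧ d₂ ≠ b ∧ d₂ ≠ z ∧ d₂ ≠ d₁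
      · obtain ⟨d₂, hw2, ha2, hb2, hz2, h12⟩ := h1
        refine ⟨d₁, d₂, Or.inr (hz _ hw1 ha1 hb1 hz1), hw1, hw2, fun d hd => ?_⟩
        by_contra! hcon
        obtain ⟨hda, hdb, hdz, hd1, hd2⟩ := hcon
        exact h3 d₁ d₂ d hw1 hw2 hd (hz _ hw1 ha1 hb1 hz1) (hz _ hw2 ha2 hb2 hz2)
          (hz _ hd hda hdb hdz) ha1 hb1 ha2 hb2 hda hdb h12.symm hd1.symm hd2.symm
      · push Not at h1
        exact ⟨d₁, z, Or.inr (hz _ hw1 ha1 hb1 hz1), hw1, hwz, fun d hd => by grind⟩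
    · push Not at h0
      exact ⟨z, z, Or.inl rfl, hwz, hwz, fun d hd => by grind⟩
  obtain ⟨d₁, d₂, hzd, hw1, hw2, hcov⟩ := key
  refine ⟨{a, b}, {z, d₁}, {d₂}, ?_, ?_, ?_, ?_⟩
  · rw [SimpleGraph.isClique_pair]; exact fun _ => hab
  · rw [SimpleGraph.isClique_pair]; intro hne; exact hzd.resolve_left hne.symm
  · exact SimpleGraph.isClique_singleton _
  · ext d
    simp only [SimpleGraph.mem_neighborSet, Set.mem_union, Set.mem_insert_iff,
      Set.mem_singleton_iff]
    constructor
    · intro hd; have := hcov d hd; tauto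
    · rintro (((rfl | rfl) | (rfl | rfl)) | rfl) <;> assumption

/-- In a `K₄`-free fork-free graph, a vertex attached to an odd hole along one edge and having a
neighbour far from the hole is trisimplicial. -/
theorem OddHole.trisimplicial_of_edge {n : ℤ} {c : ℤ → V} (h : OddHole G n c) (hf : ForkFree G)
    (hK : G.CliqueFree 4) {w z : V} {i : ℤ} (ha : G.Adj w (c i)) (hb : G.Adj w (c (i + 1)))
    (hfar : ∀ j, i + 2 ≤ j → j ≤ i + n - 1 → ¬ G.Adj w (c j)) (hwz : G.Adj w z)
    (hz : ∀ j, ¬ G.Adj z (c j)) : Trisimplicial G w := by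
  have h5 := h.five_le
  have hab := h.adj i
  have ha' : ¬ G.Adj w (c (i - 1)) := by
    rw [← h.periodic]; exact hfar _ (by omega) (by omega)
  have hb' : ¬ G.Adj w (c (i + 2)) := hfar _ (by omega) (by omega)
  have haa' : G.Adj (c i) (c (i - 1)) := (h.adj' (by ring)).symm
  have hbb' : G.Adj (c (i + 1)) (c (i + 2)) := h.adj' (by ring)
  have hab' : ¬ G.Adj (c i) (c (i + 2)) := h.not_adj' (by omega) (by omega)
  have ha'b : ¬ G.Adj (c (i - 1)) (c (i + 1)) := h.not_adj' (by omega) (by omega)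
  have hwc : ∀ j, w ≠ c j := fun j he => hz j (he ▸ hwz.symm)
  have hnotc : ∀ y, G.Adj w y → y ≠ c i → y ≠ c (i + 1) → ∀ j, y ≠ c j := by
    rintro y hy hya hyb j rfl
    obtain ⟨m, h0, hm, he⟩ := h.exists_eq_add i j
    rcases eq_or_ne m 0 with rfl | h1
    · exact hya (by simpa using he)
    rcases eq_or_ne m 1 with rfl | h2
    · exact hyb he
    · exact hfar (i + m) (by omega) (by omega) (he ▸ hy)
  have hfarclique : ∀ u v, G.Adj w u → G.Adj w v → (∀ j, ¬ G.Adj u (c j)) →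
      (∀ j, ¬ G.Adj v (c j)) → u ≠ v → G.Adj u v := by
    intro u v hu hv huc hvc hne
    by_contra huv
    exact hf.elim hu hv ha haa' hne huv (huc _) (hvc _) ha' (huc _) (hvc _)
  have hfarnear : ∀ u y, G.Adj w u → (∀ j, ¬ G.Adj u (c j)) → G.Adj w y → (∀ j, y ≠ c j) →
      (∃ j, G.Adj y (c j)) → G.Adj u y := by
    rintro u y hu huc hy hyc ⟨j, hj⟩
    by_contra huy
    have e1 := h.adj_of_edge hf ha hfar hu huc hy huy hyc hj
    have e2 := h.adj_succ_of_edge hf hb hfar hu huc hy huy hyc hj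
    exact not_k4 hK hy ha hb e1 e2 hab
  refine trisimplicial_of_no_three ha hb hwz hab ?_ ?_
  · intro d hd hda hdb hdz
    by_cases hdc : ∃ j, G.Adj d (c j)
    · exact hfarnear z d hwz hz hd (hnotc d hd hda hdb) hdc
    · push Not at hdc
      exact hfarclique z d hwz hd hz hdc hdz.symm
  · intro d₁ d₂ d₃ hw1 hw2 hw3 hz1 hz2 hz3 ha1 hb1 ha2 hb2 ha3 hb3 h12 h13 h23
    have hn : ∀ d e, G.Adj w d → G.Adj w e → G.Adj z d → G.Adj z e → ¬ G.Adj d e :=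
      fun d e hd he hzd hze hde => not_k4 hK hwz hd he hzd hze hde
    have near : ∀ d e, G.Adj w d → G.Adj w e → G.Adj z d → G.Adj z e → d ≠ c i → d ≠ c (i + 1) →
        e ≠ c i → e ≠ c (i + 1) → d ≠ e → ∃ j, G.Adj d (c j) := by
      intro d e hd he hzd hze hda hdb hea heb hde
      by_contra! hdc
      apply hn d e hd he hzd hze
      by_cases hec : ∃ j, G.Adj e (c j)
      · exact hfarnear d e hd hdc he (hnotc e he hea heb) hec
      · push Not at hec
        exact hfarclique d e hd he hdc hec hde
    have type : ∀ d, G.Adj w d → G.Adj z d → (∃ j, G.Adj d (c j)) →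
        (G.Adj d (c i) ∧ G.Adj d (c (i - 1)) ∧ ¬ G.Adj d (c (i + 1)) ∧ ¬ G.Adj d (c (i + 2))) ∨
        (G.Adj d (c (i + 1)) ∧ G.Adj d (c (i + 2)) ∧ ¬ G.Adj d (c i) ∧ ¬ G.Adj d (c (i - 1))) ∨
        (¬ G.Adj d (c i) ∧ ¬ G.Adj d (c (i + 1)) ∧
          ¬ (G.Adj d (c (i - 1)) ∧ G.Adj d (c (i + 2)))) := by
      rintro d hd hzd ⟨j, hj⟩
      have hnab : ¬ (G.Adj d (c i) ∧ G.Adj d (c (i + 1))) := fun hc =>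
        not_k4 hK hd ha hb hc.1 hc.2 hab
      rcases h.complete_or_edge hf hzd.symm hz hj with hall | ⟨k, hk, hk1, hkfar⟩
      · exact absurd ⟨hall _, hall _⟩ hnab
      have hper : ∀ t s, c (t + s) = c (t + n + s) := fun t s => by
        rw [show t + n + s = t + s + n by ring, h.periodic]
      obtain ⟨m, h0, hm, he⟩ := h.exists_shift_eq k i
      have cls : ∀ t, -1 ≤ t → t ≤ 2 → (G.Adj d (c (i + t)) ↔
          (m + t = 0 ∨ m + t = 1 ∨ m + t = n ∨ m + t = n + 1)) := by
        intro t ht1 ht2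
        rw [he]
        constructor
        · intro hadj
          by_contra! hcon
          rcases lt_or_ge (m + t) 0 with hl | hl
          · rw [show k + m + t = k + (m + t) by ring, hper] at hadj
            exact hkfar _ (by omega) (by omega) hadj
          rcases lt_or_ge (m + t) n with hl2 | hl2
          · exact hkfar _ (by omega) (by omega) hadj
          · rw [show k + m + t = (k + m + t - n) + n by ring, h.periodic] at hadj
            exact hkfar _ (by omega) (by omega) hadj
        · rintro (h1 | h1 | h1 | h1)
          · rwa [show k + m + t = k by omega]
          · rwa [show k + m + t = k + 1 by omega]
          · rwa [show k + m + t = k + n by omega, h.periodic]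
          · rwa [show k + m + t = k + 1 + n by omega, h.periodic]
      have c0 := cls 0 (by omega) (by omega)
      have c1 := cls 1 (by omega) (by omega)
      have c2 := cls 2 (by omega) (by omega)
      have c3 := cls (-1) (by omega) (by omega)
      rw [add_zero] at c0
      rw [← sub_eq_add_neg] at c3
      rw [c0, c1] at hnab
      rw [c0, c1, c2, c3]
      omega
    have pair : ∀ d e, G.Adj w d → G.Adj w e → G.Adj z d → G.Adj z e → d ≠ e →
        (¬ G.Adj d (c i) → ¬ G.Adj e (c i) →
          (G.Adj d (c (i - 1)) ∨ G.Adj e (c (i - 1))) ∧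
          (G.Adj e (c (i + 2)) → G.Adj d (c (i + 2))) ∧
          (G.Adj d (c (i + 2)) → G.Adj e (c (i + 2)))) ∧
        (¬ G.Adj d (c (i + 1)) → ¬ G.Adj e (c (i + 1)) →
          (G.Adj d (c (i + 2)) ∨ G.Adj e (c (i + 2))) ∧
          (G.Adj e (c (i - 1)) → G.Adj d (c (i - 1))) ∧
          (G.Adj d (c (i - 1)) → G.Adj e (c (i - 1)))) := by
      intro d e hd he hzd hze hde
      have hnde := hn d e hd he hzd hze
      have hned : ¬ G.Adj e d := fun h => hnde h.symm
      refine ⟨fun hda hea => ⟨?_, ?_, ?_⟩, fun hdb heb => ⟨?_, ?_, ?_⟩⟩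
      · by_contra! hcon
        exact hf.elim hd he ha haa' hde hnde hda hea ha' hcon.1 hcon.2
      · intro heb'
        by_contra hdb'
        exact hf.elim hd ha he heb' (fun hh => hz i (hh ▸ hzd)) hda hnde
          (fun hh => hea hh.symm) hb' hdb' hab'
      · intro hdb'
        by_contra heb'
        exact hf.elim he ha hd hdb' (fun hh => hz i (hh ▸ hze)) hea hned
          (fun hh => hda hh.symm) hb' heb' hab'
      · by_contra! hcon
        exact hf.elim hd he hb hbb' hde hnde hdb heb hb' hcon.1 hcon.2
      · intro hea'
        by_contra hda'
        exact hf.elim hd hb he hea' (fun hh => hz (i + 1) (hh ▸ hzd)) hdb hnde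
          (fun hh => heb hh.symm) ha' hda' (fun hh => ha'b hh.symm)
      · intro hda'
        by_contra hea'
        exact hf.elim he hb hd hda' (fun hh => hz (i + 1) (hh ▸ hze)) heb hned
          (fun hh => hdb hh.symm) ha' hea' (fun hh => ha'b hh.symm)
    have opp : ∀ d e, G.Adj w d → G.Adj w e → G.Adj z d → G.Adj z e → d ≠ c i → d ≠ c (i + 1) →
        e ≠ c i → e ≠ c (i + 1) → d ≠ e → (G.Adj d (c i) ↔ ¬ G.Adj e (c i)) := by
      intro d e hd he hzd hze hda hdb hea heb hde
      have p := pair d e hd he hzd hze hde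
      have td := type d hd hzd (near d e hd he hzd hze hda hdb hea heb hde)
      have te := type e he hze (near e d he hd hze hzd hea heb hda hdb hde.symm)
      clear pair type near hn hfarnear hfarclique
      rcases td with ⟨d1, d2, d3, d4⟩ | ⟨d1, d2, d3, d4⟩ | ⟨d1, d2, d3⟩ <;>
        rcases te with ⟨e1, e2, e3, e4⟩ | ⟨e1, e2, e3, e4⟩ | ⟨e1, e2, e3⟩ <;>
        first
          | (simp_all; done)
          | tauto
    have o12 := opp d₁ d₂ hw1 hw2 hz1 hz2 ha1 hb1 ha2 hb2 h12
    have o13 := opp d₁ d₃ hw1 hw3 hz1 hz3 ha1 hb1 ha3 hb3 h13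
    have o23 := opp d₂ d₃ hw2 hw3 hz2 hz3 ha2 hb2 ha3 hb3 h23
    clear opp pair type near hn hfarnear hfarclique
    tauto

/-- The vertices of `K` can be labelled so that the labels `0` and `1` give independent sets and
the label `2` gives a triangle-free set. -/
def HasSplit (G : SimpleGraph V) (K : Set V) : Prop :=
  ∃ f : V → Fin 3, (∀ x ∈ K, ∀ y ∈ K, G.Adj x y → f x = f y → f x = 2) ∧
    ∀ x ∈ K, ∀ y ∈ K, ∀ z ∈ K, G.Adj x y → G.Adj y z → G.Adj x z →
      f x = 2 → f y = 2 → f z = 2 → False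

theorem hasSplit_of_set {K : Set V} (A : Set V)
    (htri : ∀ x ∈ K, ∀ y ∈ K, ∀ z ∈ K, x ∈ A → y ∈ A → z ∈ A →
      G.Adj x y → G.Adj y z → G.Adj x z → False)
    (hhole : ∀ n c, OddHole G n c → (∀ i, c i ∈ K) → (∀ i, c i ∈ A) → False)
    (hB : ∀ x ∈ K, ∀ y ∈ K, ∀ z ∈ K, x ∉ A → y ∉ A → z ∉ A →
      G.Adj x y → G.Adj y z → G.Adj x z → False) : HasSplit G K := by
  classical
  obtain ⟨C⟩ := exists_bicoloring (G := G) (A := K ∩ A)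
    (fun x hx y hy z hz => htri x hx.1 y hy.1 z hz.1 hx.2 hy.2 hz.2)
    (fun n c h hc => hhole n c h (fun i => (hc i).1) (fun i => (hc i).2))
  have hmem : ∀ x, x ∈ K → (if hx : x ∈ K ∩ A then (C ⟨x, hx⟩).castSucc else (2 : Fin 3)) = 2 →
      x ∉ A := by
    intro x hxK hx hxA
    rw [dif_pos ⟨hxK, hxA⟩] at hx
    have := congrArg Fin.val hx
    have := (C ⟨x, hxK, hxA⟩).isLt
    simp at *
    omega
  refine ⟨fun x => if hx : x ∈ K ∩ A then (C ⟨x, hx⟩).castSucc else 2, ?_, ?_⟩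
  · intro x hx y hy hxy he
    by_contra hne
    have hne' := he ▸ hne
    dsimp only at hne hne' he
    have hxA : x ∈ K ∩ A := by by_contra hc; exact hne (dif_neg hc)
    have hyA : y ∈ K ∩ A := by by_contra hc; exact hne' (dif_neg hc)
    rw [dif_pos hxA, dif_pos hyA] at he
    exact C.valid (show (G.induce (K ∩ A)).Adj ⟨x, hxA⟩ ⟨y, hyA⟩ from hxy)
      (Fin.castSucc_injective _ he)
  · intro x hx y hy z hz xy yz xz fx fy fz
    exact hB x hx y hy z hz (hmem x hx fx) (hmem y hy fy) (hmem z hz fz) xy yz xz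

theorem SimpleGraph.Reachable.induct {P : V → Prop} (step : ∀ x y, G.Adj x y → P x → P y) {x y : V}
    (h : G.Reachable x y) (hx : P x) : P y := by
  obtain ⟨p⟩ := h
  induction p with
  | nil => exact hx
  | cons hadj _ ih => exact ih (step _ _ hadj hx)

/-- If some neighbour of an odd hole has a neighbour far from the hole, then the component of the
hole splits. -/
theorem OddHole.hasSplit_of_far (hf : ForkFree G) (hK : G.CliqueFree 4)
    (ht : ∀ u, ¬ Trisimplicial G u) {n : ℤ} {c : ℤ → V} (h : OddHole G n c) {w z : V} {i₀ : ℤ}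
    (hwz : G.Adj w z) (hz : ∀ j, ¬ G.Adj z (c j)) (hi₀ : G.Adj w (c i₀)) {K : Set V}
    (hKw : ∀ x ∈ K, G.Reachable w x) : HasSplit G K := by
  have h5 := h.five_le
  have hcz : ∀ {y j}, G.Adj y z → G.Adj y (c j) → ∀ i, G.Adj y (c i) := by
    intro y j hyz hj
    rcases h.complete_or_edge hf hyz hz hj with hall | ⟨i, h1, h2, h3⟩
    · exact hall
    · exact absurd (h.trisimplicial_of_edge hf hK h1 h2 h3 hyz hz) (ht _)
  have hw := hcz hwz hi₀
  have hcomp : ∀ {y j}, (∀ i, y ≠ c i) → G.Adj y (c j) → ∀ i, G.Adj y (c i) := by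
    intro y j hyc hj
    by_cases hyz : G.Adj y z
    · exact hcz hyz hj
    by_cases hwy : G.Adj w y
    · obtain ⟨k, hk, hk1⟩ := h.exists_consecutive hf hyc hj
      exact (not_k4 hK hwy (hw _) (hw _) hk hk1 (h.adj k)).elim
    · refine h.forall_of_step_two (P := fun v => G.Adj y v) hj fun k hk => ?_
      by_contra hk2
      exact hf.elim hwz (hw (k + 2)) (hw k) hk.symm (h.ne_of_forall_not_adj hz _) (hz _) (hz _)
        (fun ha => h.not_adj' (by omega) (by omega) ha.symm) hwy (fun ha => hyz ha.symm)
        (fun ha => hk2 ha.symm)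
  have hstable : ∀ {y y'}, (∀ i, G.Adj y (c i)) → (∀ i, G.Adj y' (c i)) → ¬ G.Adj y y' :=
    fun hy hy' hyy => not_k4 hK hyy (hy 0) (hy 1) (hy' 0) (hy' 1) (h.adj 0)
  have hprop : ∀ {x x' y}, (∀ i, x ≠ c i) → (¬ ∀ i, G.Adj x (c i)) → (∀ i, x' ≠ c i) →
      (¬ ∀ i, G.Adj x' (c i)) → G.Adj x x' → (∀ i, G.Adj y (c i)) → G.Adj x y → G.Adj x' y := by
    intro x x' y hx hx' hxx hxx' hadj hy hxy
    by_contra hcon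
    exact hf.elim (hy 0) (hy 2) hxy.symm hadj (h.ne (by omega) (by omega))
      (h.not_adj' (by omega) (by omega)) (fun ha => hx' (hcomp hx ha.symm))
      (fun ha => hx' (hcomp hx ha.symm)) (fun ha => hcon ha.symm)
      (fun ha => hxx' (hcomp hxx ha.symm)) (fun ha => hxx' (hcomp hxx ha.symm))
  have hcover : ∀ x ∈ K, (∀ i, G.Adj x (c i)) ∨ (∃ j, x = c j) ∨
      ∃ y, (∀ i, G.Adj y (c i)) ∧ G.Adj x y := by
    intro x hx
    refine (hKw x hx).induct (P := fun x => (∀ i, G.Adj x (c i)) ∨ (∃ j, x = c j) ∨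
      ∃ y, (∀ i, G.Adj y (c i)) ∧ G.Adj x y) ?_ (Or.inl hw)
    intro a b hab ha
    by_cases hb1 : ∀ i, G.Adj b (c i)
    · exact Or.inl hb1
    by_cases hb2 : ∃ j, b = c j
    · exact Or.inr (Or.inl hb2)
    by_cases ha1 : ∀ i, G.Adj a (c i)
    · exact Or.inr (Or.inr ⟨a, ha1, hab.symm⟩)
    push Not at hb2
    by_cases ha2 : ∃ j, a = c j
    · obtain ⟨j, rfl⟩ := ha2
      exact absurd (hcomp hb2 hab.symm) hb1
    · obtain ⟨y, hy, hay⟩ := (ha.resolve_left ha1).resolve_left ha2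
      push Not at ha2
      exact Or.inr (Or.inr ⟨y, hy, hprop ha2 ha1 hb2 hb1 hab hy hay⟩)
  refine hasSplit_of_set {y | ∀ i, G.Adj y (c i)}
    (fun x _ y _ _ _ hx hy _ hxy _ _ => hstable hx hy hxy)
    (fun m d hd _ hdA => hstable (hdA 0) (hdA 1) (hd.adj 0)) ?_
  intro x hx y _ u _ hxA hyA huA hxy hyu hxu
  have hole : ∀ {a b}, (¬ ∀ i, G.Adj b (c i)) → G.Adj a b → (∃ j, a = c j) → ∃ j, b = c j := by
    rintro a b hb hab ⟨j, rfl⟩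
    by_contra! hcon
    exact hb (hcomp hcon hab.symm)
  by_cases hxc : ∃ j, x = c j
  · obtain ⟨k, rfl⟩ := hole hyA hxy hxc
    obtain ⟨l, rfl⟩ := hole huA hxu hxc
    obtain ⟨j, rfl⟩ := hxc
    exact not_k4 hK (hw _) (hw _) (hw _) hxy hxu hyu
  have hyc : ∀ j, y ≠ c j := fun j hj => hxc (hole hxA hxy.symm ⟨j, hj⟩)
  have huc : ∀ j, u ≠ c j := fun j hj => hxc (hole hxA hxu.symm ⟨j, hj⟩)
  obtain ⟨t, ht', hxt⟩ := ((hcover x hx).resolve_left hxA).resolve_left hxc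
  push Not at hxc
  exact not_k4 hK hxy hxu hxt hyu (hprop hxc hxA hyc hyA hxy ht' hxt)
    (hprop hxc hxA huc huA hxu ht' hxt)

/-- Every vertex adjacent to a neighbour of an odd hole in `K` is a neighbour of that hole. -/
def HolesAbsorb (G : SimpleGraph V) (K : Set V) : Prop :=
  ∀ n c, OddHole G n c → (∀ i, c i ∈ K) → ∀ w z i₀, G.Adj w z → G.Adj w (c i₀) →
    ∃ j, G.Adj z (c j)

theorem HolesAbsorb.exists_adj {K : Set V} (habs : HolesAbsorb G K)
    (hconn : ∀ x ∈ K, ∀ y ∈ K, G.Reachable x y) {n : ℤ} {c : ℤ → V} (h : OddHole G n c)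
    (hc : ∀ i, c i ∈ K) {x : V} (hx : x ∈ K) : ∃ j, G.Adj x (c j) :=
  (hconn _ (hc 0) _ hx).induct (P := fun x => ∃ j, G.Adj x (c j))
    (fun a b hab ⟨j, hj⟩ => habs n c h hc a b j hab hj) ⟨1, h.adj 0⟩

theorem HolesAbsorb.hasSplit {K : Set V} (habs : HolesAbsorb G K)
    (hconn : ∀ x ∈ K, ∀ y ∈ K, G.Reachable x y) {v : V} (hv : v ∈ K) (A : Set V)
    (hvA : ∀ x ∈ A, ¬ G.Adj v x)
    (htri : ∀ x ∈ K, ∀ y ∈ K, ∀ z ∈ K, x ∈ A → y ∈ A → z ∈ A →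
      G.Adj x y → G.Adj y z → G.Adj x z → False)
    (hB : ∀ x ∈ K, ∀ y ∈ K, ∀ z ∈ K, x ∉ A → y ∉ A → z ∉ A →
      G.Adj x y → G.Adj y z → G.Adj x z → False) : HasSplit G K := by
  refine hasSplit_of_set A htri (fun n c h hcK hcA => ?_) hB
  obtain ⟨j, hj⟩ := habs.exists_adj hconn h hcK hv
  exact hvA _ (hcA j) hj

/-- The component splits when some vertex has a large independent set of neighbours. -/
theorem hasSplit_of_independent [Finite V] (hf : ForkFree G) (hK4 : G.CliqueFree 4) {K : Set V}
    (habs : HolesAbsorb G K) (hconn : ∀ x ∈ K, ∀ y ∈ K, G.Reachable x y)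
    (hclosed : ∀ x ∈ K, ∀ y, G.Adj x y → y ∈ K) {v : V} (hv : v ∈ K) {S : Finset V}
    (hS : ∀ s ∈ S, G.Adj v s) (hind : ∀ s ∈ S, ∀ t ∈ S, ¬ G.Adj s t) (hcard : 4 ≤ S.card)
    (hmax : ∀ u ∈ K, ∀ T : Finset V, (∀ s ∈ T, G.Adj u s) → (∀ s ∈ T, ∀ t ∈ T, ¬ G.Adj s t) →
      T.card ≤ S.card) : HasSplit G K := by
  classical
  obtain ⟨o, ho⟩ := Countable.exists_injective_nat V
  let M (x : V) : Prop := ∀ s ∈ S, ∀ t ∈ S, ¬ G.Adj x s → ¬ G.Adj x t → s = t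
  let E (x : V) : Prop := ¬ G.Adj v x ∧ ∀ s ∈ S, ¬ G.Adj x s
  have hM : ∀ {x}, M x → (S.filter fun s => ¬ G.Adj x s).card ≤ 1 := fun {x} hx =>
    Finset.card_le_one.2 fun a ha b hb => by
      rw [Finset.mem_filter] at ha hb
      exact hx a ha.1 b hb.1 ha.2 hb.2
  have hMadj : ∀ {x}, M x → S.card - 1 ≤ (S.filter fun s => G.Adj x s).card := fun {x} hx => by
    have := S.card_filter_add_card_filter_not (fun s => G.Adj x s)
    have := hM hx
    omega
  have hM2 : ∀ {x}, M x → ∃ s ∈ S, ∃ t ∈ S, s ≠ t ∧ G.Adj x s ∧ G.Adj x t := fun {x} hx => by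
    have := hMadj hx
    obtain ⟨a, ha, b, hb, hab⟩ := Finset.one_lt_card.1
      (show 1 < (S.filter fun s => G.Adj x s).card by omega)
    rw [Finset.mem_filter] at ha hb
    exact ⟨a, ha.1, b, hb.1, hab, ha.2, hb.2⟩
  have hM3 : ∀ {x y z}, M x → M y → M z → ∃ s ∈ S, G.Adj x s ∧ G.Adj y s ∧ G.Adj z s := by
    intro x y z hx hy hz
    by_contra! hcon
    have hsub : S ⊆ (S.filter fun s => ¬ G.Adj x s) ∪ (S.filter fun s => ¬ G.Adj y s) ∪
        (S.filter fun s => ¬ G.Adj z s) := by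
      intro s hs
      have := hcon s hs
      simp only [Finset.mem_union, Finset.mem_filter]
      tauto
    have h1 := Finset.card_le_card hsub
    have h2 := Finset.card_union_le ((S.filter fun s => ¬ G.Adj x s) ∪
      (S.filter fun s => ¬ G.Adj y s)) (S.filter fun s => ¬ G.Adj z s)
    have h3 := Finset.card_union_le (S.filter fun s => ¬ G.Adj x s) (S.filter fun s => ¬ G.Adj y s)
    have := hM hx
    have := hM hy
    have := hM hz
    omega
  have hEv : ¬ E v := fun h => by
    obtain ⟨s, hs⟩ := Finset.card_pos.1 (show 0 < S.card by omega)
    exact h.2 s hs (hS s hs)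
  have hmiss : ∀ {x}, ¬ G.Adj v x → ¬ E x → M x := by
    intro x hvx hE s hs t ht hxs hxt
    by_contra hst
    simp only [E, not_and, not_forall, not_not] at hE
    obtain ⟨r, hr, hxr⟩ := hE hvx
    exact hf.elim (hS s hs) (hS t ht) (hS r hr) hxr.symm hst (hind _ hs _ ht) (hind _ hs _ hr)
      (hind _ ht _ hr) hvx (fun h => hxs h.symm) (fun h => hxt h.symm)
  have hatt : ∀ {x e}, E e → ¬ E x → G.Adj x e → M x := by
    intro x e he hx hxe
    by_cases hvx : G.Adj v x
    · intro s hs t ht hxs hxt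
      by_contra hst
      exact hf.elim (hS s hs) (hS t ht) hvx hxe hst (hind _ hs _ ht) (fun h => hxs h.symm)
        (fun h => hxt h.symm) he.1 (fun h => he.2 s hs h.symm) (fun h => he.2 t ht h.symm)
    · exact hmiss hvx hx
  have hspread : ∀ {x e e'}, E e → E e' → ¬ E x → G.Adj e e' → G.Adj x e → G.Adj x e' := by
    intro x e e' he he' hx hee hxe
    by_contra hcon
    obtain ⟨s, hs, t, ht, hst, hxs, hxt⟩ := hM2 (hatt he hx hxe)
    exact hf.elim hxs hxt hxe hee hst (hind _ hs _ ht) (fun h => he.2 s hs h.symm)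
      (fun h => he.2 t ht h.symm) hcon (fun h => he'.2 s hs h.symm) (fun h => he'.2 t ht h.symm)
  have hjoin : ∀ {x e e'}, x ∈ K → E e → E e' → ¬ E x → G.Adj x e → G.Adj x e' → e ≠ e' →
      G.Adj e e' := by
    intro x e e' hxK he he' hx hxe hxe' hne
    by_contra hcon
    have heS : e ∉ S := fun h => he.1 (hS e h)
    have heS' : e' ∉ S := fun h => he'.1 (hS e' h)
    have hc : ¬ G.Adj e' e := fun h => hcon h.symm
    have hle := hmax x hxK (insert e (insert e' (S.filter fun s => G.Adj x s))) (by
      intro s hs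
      simp only [Finset.mem_insert, Finset.mem_filter] at hs
      rcases hs with rfl | rfl | hs
      exacts [hxe, hxe', hs.2]) (by
      intro s hs t ht
      simp only [Finset.mem_insert, Finset.mem_filter] at hs ht
      rcases hs with rfl | rfl | hs <;> rcases ht with rfl | rfl | ht
      exacts [G.irrefl, hcon, he.2 _ ht.1, hc, G.irrefl, he'.2 _ ht.1,
        fun h => he.2 _ hs.1 h.symm, fun h => he'.2 _ hs.1 h.symm, hind _ hs.1 _ ht.1])
    rw [Finset.card_insert_of_notMem (by simp [hne, heS]),
      Finset.card_insert_of_notMem (by simp [heS'])] at hle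
    have := hMadj (hatt he hx hxe)
    omega
  have hex : ∀ {e}, e ∈ K → E e → ∃ x, ¬ E x ∧ G.Adj x e := by
    intro e heK
    refine (hconn v hv e heK).induct (P := fun e => E e → ∃ x, ¬ E x ∧ G.Adj x e) ?_
      (fun h => absurd h hEv)
    intro a b hab ha hb
    by_cases haE : E a
    · obtain ⟨x, hx, hxa⟩ := ha haE
      exact ⟨x, hx, hspread haE hb hx hab hxa⟩
    · exact ⟨a, haE, hab⟩
  have huniq : ∀ {e a b}, e ∈ K → E e → E a → E b → G.Adj e a → G.Adj e b → a = b := by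
    intro e a b heK he ha hb hea heb
    by_contra hne
    obtain ⟨x, hx, hxe⟩ := hex heK he
    have hxa := hspread he ha hx hea hxe
    have hxb := hspread he hb hx heb hxe
    exact not_k4 hK4 hxe hxa hxb hea heb
      (hjoin (hclosed e heK x hxe.symm) ha hb hx hxa hxb hne)
  refine habs.hasSplit hconn hv
    {x | ¬ G.Adj v x ∧ ¬ (E x ∧ ∀ e, E e → G.Adj x e → o x < o e)} (fun x hx => hx.1) ?_ ?_
  · have hEE : ∀ {x y}, x ∈ K → y ∈ K → ¬ (E x ∧ ∀ e, E e → G.Adj x e → o x < o e) →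
        ¬ (E y ∧ ∀ e, E e → G.Adj y e → o y < o e) → G.Adj x y → E x → ¬ E y := by
      intro x y hxK hyK hx hy hxy hxE hyE
      simp only [not_and, not_forall] at hx hy
      obtain ⟨a, ha, hxa, hlt⟩ := hx hxE
      obtain ⟨b, hb, hyb, hlt'⟩ := hy hyE
      rw [huniq hxK hxE ha hyE hxa hxy] at hlt
      rw [huniq hyK hyE hb hxE hyb hxy.symm] at hlt'
      exact hxy.ne (ho (by omega))
    have hnE : ∀ {x y z}, x ∈ K → y ∈ K → z ∈ K →
        ¬ (E x ∧ ∀ e, E e → G.Adj x e → o x < o e) → ¬ (E y ∧ ∀ e, E e → G.Adj y e → o y < o e) →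
        ¬ (E z ∧ ∀ e, E e → G.Adj z e → o z < o e) →
        G.Adj x y → G.Adj y z → G.Adj x z → ¬ E x := by
      intro x y z hxK hyK hzK hx hy hz hxy hyz hxz hxE
      have hyE := hEE hxK hyK hx hy hxy hxE
      have hzE := hEE hxK hzK hx hz hxz hxE
      simp only [not_and, not_forall] at hx
      obtain ⟨a, ha, hxa, -⟩ := hx hxE
      exact not_k4 hK4 hxy hxz hxa hyz (hspread hxE ha hyE hxa hxy.symm)
        (hspread hxE ha hzE hxa hxz.symm)
    intro x hxK y hyK z hzK hx hy hz hxy hyz hxz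
    obtain ⟨s, -, hxs, hys, hzs⟩ := hM3
      (hmiss hx.1 (hnE hxK hyK hzK hx.2 hy.2 hz.2 hxy hyz hxz))
      (hmiss hy.1 (hnE hyK hxK hzK hy.2 hx.2 hz.2 hxy.symm hxz hyz))
      (hmiss hz.1 (hnE hzK hxK hyK hz.2 hx.2 hy.2 hxz.symm hxy hyz.symm))
    exact not_k4 hK4 hxy hxz hxs hyz hys hzs
  · have hx' : ∀ {x}, ¬ (¬ G.Adj v x ∧ ¬ (E x ∧ ∀ e, E e → G.Adj x e → o x < o e)) →
        G.Adj v x ∨ (E x ∧ ∀ e, E e → G.Adj x e → o x < o e) := fun {x} h => by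
      by_contra hcon
      exact h (not_or.1 hcon)
    have hmin : ∀ {x y z}, (E x ∧ ∀ e, E e → G.Adj x e → o x < o e) →
        (G.Adj v y ∨ (E y ∧ ∀ e, E e → G.Adj y e → o y < o e)) →
        (G.Adj v z ∨ (E z ∧ ∀ e, E e → G.Adj z e → o z < o e)) →
        G.Adj x y → G.Adj y z → G.Adj x z → False := by
      intro x y z hx hy hz hxy hyz hxz
      rcases hy with hy | hy
      · rcases hz with hz | hz
        · obtain ⟨s, hs, hys, hzs, -⟩ := hM3 (hatt hx.1 (fun h => h.1 hy) hxy.symm)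
            (hatt hx.1 (fun h => h.1 hz) hxz.symm) (hatt hx.1 (fun h => h.1 hz) hxz.symm)
          exact not_k4 hK4 hy hz (hS s hs) hyz hys hzs
        · exact lt_asymm (hx.2 z hz.1 hxz) (hz.2 x hx.1 hxz.symm)
      · exact lt_asymm (hx.2 y hy.1 hxy) (hy.2 x hx.1 hxy.symm)
    intro x _ y _ z _ hx hy hz hxy hyz hxz
    replace hx := hx' hx
    replace hy := hx' hy
    replace hz := hx' hz
    rcases hx with hx | hx
    · rcases hy with hy | hy
      · rcases hz with hz | hz
        · exact not_k4 hK4 hx hy hz hxy hxz hyz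
        · exact hmin hz (Or.inl hx) (Or.inl hy) hxz.symm hxy hyz.symm
      · exact hmin hy (Or.inl hx) hz hxy.symm hxz hyz
    · exact hmin hx hy hz hxy hyz hxz

/-- A vertex with bipartite neighbourhood containing no independent set of size four is
trisimplicial. -/
theorem trisimplicial_of_bipartite [Finite V] {v : V}
    (hcol : (G.induce (G.neighborSet v)).Colorable 2)
    (hind : ∀ T : Finset V, (∀ s ∈ T, G.Adj v s) → (∀ s ∈ T, ∀ t ∈ T, ¬ G.Adj s t) →
      T.card ≤ 3) : Trisimplicial G v := by
  classical
  have := Fintype.ofFinite V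
  obtain ⟨C⟩ := hcol
  let X (i : Fin 2) : Finset V := Finset.univ.filter fun x => ∃ h : G.Adj v x, C ⟨x, h⟩ = i
  have hX : ∀ {i x}, x ∈ X i ↔ ∃ h : G.Adj v x, C ⟨x, h⟩ = i := by simp [X]
  have hXv : ∀ {i x}, x ∈ X i → G.Adj v x := fun h => (hX.1 h).1
  have hXind : ∀ {i x y}, x ∈ X i → y ∈ X i → ¬ G.Adj x y := by
    intro i x y hx hy hxy
    obtain ⟨h1, h2⟩ := hX.1 hx
    obtain ⟨h3, h4⟩ := hX.1 hy
    exact C.valid (show (G.induce (G.neighborSet v)).Adj ⟨x, h1⟩ ⟨y, h3⟩ from hxy) (h2.trans h4.symm)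
  have hXdisj : ∀ {x}, x ∈ X 0 → x ∉ X 1 := by
    intro x hx hy
    obtain ⟨h1, h2⟩ := hX.1 hx
    obtain ⟨h3, h4⟩ := hX.1 hy
    rw [h2] at h4
    exact absurd h4 (by decide)
  have hXcov : ∀ {x}, G.Adj v x → x ∈ X 0 ∨ x ∈ X 1 := by
    intro x hx
    have h2 : ∀ a : Fin 2, a = 0 ∨ a = 1 := by decide
    rcases h2 (C ⟨x, hx⟩) with h | h
    · exact Or.inl (hX.2 ⟨hx, h⟩)
    · exact Or.inr (hX.2 ⟨hx, h⟩)
  have hX1 : (X 1).card ≤ 3 := hind _ (fun s => hXv) (fun s hs t ht => hXind hs ht)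
  let D : Finset (Fin 3) := Finset.univ.filter fun i => (i : ℕ) < 3 - (X 1).card
  have hD : D.card = 3 - (X 1).card := by
    have : ∀ m, m ≤ 3 → (Finset.univ.filter fun i : Fin 3 => (i : ℕ) < m).card = m := by decide
    exact this _ (by omega)
  let t (x : X 0) : Finset (V ⊕ Fin 3) := ((X 1).filter fun y => G.Adj x y).disjSum D
  obtain ⟨f, hf, hft⟩ := (Finset.all_card_le_biUnion_card_iff_exists_injective t).1 (by
    intro s
    let N : Finset V := (X 1).filter fun y => ∃ x ∈ s, G.Adj (x : V) y
    have hs : ∀ {a}, a ∈ s.map ⟨Subtype.val, Subtype.val_injective⟩ → a ∈ X 0 := by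
      simp only [Finset.mem_map, Function.Embedding.coeFn_mk]
      rintro a ⟨b, -, rfl⟩
      exact b.2
    have hnadj : ∀ {a b}, a ∈ s.map ⟨Subtype.val, Subtype.val_injective⟩ → b ∈ X 1 \ N →
        ¬ G.Adj a b := by
      intro a b ha hb hab
      simp only [Finset.mem_map, Function.Embedding.coeFn_mk] at ha
      obtain ⟨a, ha, rfl⟩ := ha
      rw [Finset.mem_sdiff] at hb
      exact hb.2 (Finset.mem_filter.2 ⟨hb.1, a, ha, hab⟩)
    have h3 := hind (s.map ⟨Subtype.val, Subtype.val_injective⟩ ∪ (X 1 \ N)) (by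
      intro a ha
      rcases Finset.mem_union.1 ha with ha | ha
      · exact hXv (hs ha)
      · exact hXv (Finset.mem_sdiff.1 ha).1) (by
      intro a ha b hb
      rcases Finset.mem_union.1 ha with ha | ha <;> rcases Finset.mem_union.1 hb with hb | hb
      · exact hXind (hs ha) (hs hb)
      · exact hnadj ha hb
      · exact fun h => hnadj hb ha h.symm
      · exact hXind (Finset.mem_sdiff.1 ha).1 (Finset.mem_sdiff.1 hb).1)
    have hc : (X 1 \ N).card = (X 1).card - N.card :=
      Finset.card_sdiff_of_subset (Finset.filter_subset _ _)
    rw [Finset.card_union_of_disjoint (Finset.disjoint_left.2 fun a ha hb =>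
      hXdisj (hs ha) (Finset.mem_sdiff.1 hb).1), Finset.card_map, hc] at h3
    have hN : N.card ≤ (X 1).card := Finset.card_le_card (Finset.filter_subset _ _)
    rcases s.eq_empty_or_nonempty with rfl | ⟨x₀, hx₀⟩
    · simp
    have hsub : N.disjSum D ⊆ s.biUnion t := by
      intro a ha
      rw [Finset.mem_biUnion]
      rcases Finset.mem_disjSum.1 ha with ⟨b, hb, rfl⟩ | ⟨b, hb, rfl⟩
      · obtain ⟨hb1, x, hx, hxb⟩ := Finset.mem_filter.1 hb
        exact ⟨x, hx, Finset.inl_mem_disjSum.2 (Finset.mem_filter.2 ⟨hb1, hxb⟩)⟩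
      · exact ⟨x₀, hx₀, Finset.inr_mem_disjSum.2 hb⟩
    have := Finset.card_le_card hsub
    rw [Finset.card_disjSum, hD] at this
    omega)
  have hT : ((X 1).disjSum D).card = 3 := by rw [Finset.card_disjSum, hD]; omega
  obtain ⟨a, b, d, -, -, -, habd⟩ := Finset.card_eq_three.1 hT
  let Q (τ : V ⊕ Fin 3) : Set V :=
    {x | G.Adj v x ∧ ((x ∈ X 1 ∧ Sum.inl x = τ) ∨ ∃ hx : x ∈ X 0, f ⟨x, hx⟩ = τ)}
  have hadj : ∀ {x y} (hy : y ∈ X 0), x ∈ X 1 → Sum.inl x = f ⟨y, hy⟩ → G.Adj y x := by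
    intro x y hy _ he
    have := hft ⟨y, hy⟩
    rw [← he] at this
    exact (Finset.mem_filter.1 (Finset.inl_mem_disjSum.1 this)).2
  have hQ : ∀ τ, G.IsClique (Q τ) := by
    rintro τ x ⟨-, hx⟩ y ⟨-, hy⟩ hne
    rcases hx with ⟨hx, rfl⟩ | ⟨hx, rfl⟩ <;> rcases hy with ⟨hy, he⟩ | ⟨hy, he⟩
    · exact absurd (Sum.inl_injective he).symm hne
    · exact (hadj hy hx he.symm).symm
    · exact hadj hx hy he
    · exact absurd (congrArg Subtype.val (hf he)).symm hne
  refine ⟨Q a, Q b, Q d, hQ a, hQ b, hQ d, ?_⟩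
  ext x
  refine ⟨fun hx => ?_, ?_⟩
  · have key : ∃ τ ∈ (X 1).disjSum D, x ∈ Q τ := by
      rcases hXcov hx with h | h
      · refine ⟨f ⟨x, h⟩, ?_, hx, Or.inr ⟨h, rfl⟩⟩
        exact Finset.disjSum_mono (Finset.filter_subset _ _) subset_rfl (hft ⟨x, h⟩)
      · exact ⟨Sum.inl x, Finset.inl_mem_disjSum.2 h, hx, Or.inl ⟨h, rfl⟩⟩
    obtain ⟨τ, hτ, hxτ⟩ := key
    rw [habd] at hτ
    simp only [Finset.mem_insert, Finset.mem_singleton] at hτ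
    rcases hτ with rfl | rfl | rfl
    exacts [Or.inl (Or.inl hxτ), Or.inl (Or.inr hxτ), Or.inr hxτ]
  · rintro ((h | h) | h) <;> exact h.1

set_option maxRecDepth 10000 in
theorem exists_common_of_seven {a b d : Fin 7 → Bool}
    (h : ∀ p ∈ ({a, b, d} : Set (Fin 7 → Bool)), (∃ i, p i = true) ∧
      ∀ i, (p i = true → p (i + 2) = true ∨ p (i + 4) = true) ∧
        (p (i + 2) = true → p i = true ∨ p (i + 4) = true) ∧
        (p (i + 4) = true → p i = true ∨ p (i + 2) = true)) :
    ∃ i, a i = true ∧ b i = true ∧ d i = true := by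
  have key : ∀ p : Fin 7 → Bool, (∃ i, p i = true) →
      (∀ i, (p i = true → p (i + 2) = true ∨ p (i + 4) = true) ∧
        (p (i + 2) = true → p i = true ∨ p (i + 4) = true) ∧
        (p (i + 4) = true → p i = true ∨ p (i + 2) = true)) →
      (Finset.univ.filter fun i => p i = false).card ≤ 2 := by decide
  by_contra! hcon
  have h1 := key a (h a (by simp)).1 (h a (by simp)).2
  have h2 := key b (h b (by simp)).1 (h b (by simp)).2
  have h3 := key d (h d (by simp)).1 (h d (by simp)).2
  have hsub : (Finset.univ : Finset (Fin 7)) ⊆ (Finset.univ.filter fun i => a i = false) ∪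
      (Finset.univ.filter fun i => b i = false) ∪ (Finset.univ.filter fun i => d i = false) := by
    intro i _
    have := hcon i
    simp only [Finset.mem_union, Finset.mem_filter, Finset.mem_univ, true_and]
    revert this
    cases a i <;> cases b i <;> cases d i <;> simp
  have h4 := Finset.card_le_card hsub
  have h5 := Finset.card_union_le ((Finset.univ.filter fun i => a i = false) ∪
      (Finset.univ.filter fun i => b i = false)) (Finset.univ.filter fun i => d i = false)
  have h6 := Finset.card_union_le (Finset.univ.filter fun i => a i = false)
    (Finset.univ.filter fun i => b i = false)
  rw [Finset.card_univ, Fintype.card_fin] at h4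
  omega

/-- If the neighbourhood of `v` is an odd hole, then it is a hole of length seven unless `v` is
trisimplicial or has four pairwise nonadjacent neighbours. -/
theorem OddHole.length_eq_seven {n : ℤ} {c : ℤ → V} (h : OddHole G n c) {v : V}
    (hv : ¬ Trisimplicial G v) (hvc : ∀ i, G.Adj v (c i)) (hcov : ∀ y, G.Adj v y → ∃ i, y = c i)
    (hind : ∀ T : Finset V, (∀ s ∈ T, G.Adj v s) → (∀ s ∈ T, ∀ t ∈ T, ¬ G.Adj s t) →
      T.card ≤ 3) : n = 7 := by
  classical
  have h5 := h.five_le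
  obtain ⟨k, hk⟩ := h.odd
  by_contra hne
  rcases eq_or_ne n 5 with rfl | h5'
  · refine hv ⟨{c 0, c 1}, {c 2, c 3}, {c 4}, ?_, ?_, SimpleGraph.isClique_singleton _, ?_⟩
    · rw [SimpleGraph.isClique_pair]; exact fun _ => h.adj 0
    · rw [SimpleGraph.isClique_pair]; exact fun _ => h.adj 2
    · ext y
      simp only [SimpleGraph.mem_neighborSet, Set.mem_union, Set.mem_insert_iff,
        Set.mem_singleton_iff]
      constructor
      · intro hy
        obtain ⟨i, rfl⟩ := hcov y hy
        obtain ⟨m, h0, hm, he⟩ := h.exists_eq_add 0 i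
        rw [he]
        obtain rfl | rfl | rfl | rfl | rfl : m = 0 ∨ m = 1 ∨ m = 2 ∨ m = 3 ∨ m = 4 := by omega
        all_goals simp
      · rintro (((rfl | rfl) | (rfl | rfl)) | rfl) <;> exact hvc _
  · have h8 : 8 ≤ n := by omega
    have hle := hind {c 0, c 2, c 4, c 6} (by
      intro s hs
      simp only [Finset.mem_insert, Finset.mem_singleton] at hs
      rcases hs with rfl | rfl | rfl | rfl <;> exact hvc _) (by
      intro s hs t ht
      simp only [Finset.mem_insert, Finset.mem_singleton] at hs ht
      rcases hs with rfl | rfl | rfl | rfl <;> rcases ht with rfl | rfl | rfl | rfl <;>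
        first
          | exact G.irrefl
          | exact h.not_adj' (by omega) (by omega)
          | exact fun ha => h.not_adj' (by omega) (by omega) ha.symm)
    have e1 : c 0 ≠ c 2 := h.ne (by omega) (by omega)
    have e2 : c 0 ≠ c 4 := h.ne (by omega) (by omega)
    have e3 : c 0 ≠ c 6 := h.ne (by omega) (by omega)
    have e4 : c 2 ≠ c 4 := h.ne (by omega) (by omega)
    have e5 : c 2 ≠ c 6 := h.ne (by omega) (by omega)
    have e6 : c 4 ≠ c 6 := h.ne (by omega) (by omega)
    simp [e1, e2, e3, e4, e5, e6] at hle

/-- Three vertices outside the neighbourhood of `v` which all have neighbours in a hole of length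
seven complete to `v` have a common neighbour in the hole. -/
theorem OddHole.exists_common_neighbor (hf : ForkFree G) {c : ℤ → V} (h : OddHole G 7 c) {v : V}
    (hvc : ∀ i, G.Adj v (c i)) {x y z : V} (hx : ¬ G.Adj v x) (hy : ¬ G.Adj v y)
    (hz : ¬ G.Adj v z) (hxc : ∃ i, G.Adj x (c i)) (hyc : ∃ i, G.Adj y (c i))
    (hzc : ∃ i, G.Adj z (c i)) : ∃ i, G.Adj x (c i) ∧ G.Adj y (c i) ∧ G.Adj z (c i) := by
  classical
  have hper : ∀ i j : ℤ, i % 7 = j % 7 → c i = c j := by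
    intro i j hij
    have hp : Function.Periodic c 7 := h.periodic
    rw [← hp.sub_zsmul_eq (i / 7) (x := i), ← hp.sub_zsmul_eq (j / 7) (x := j)]
    congr 1
    simp only [smul_eq_mul]
    omega
  have hadd : ∀ i k : Fin 7, c ((i + k : Fin 7) : ℕ) = c ((i : ℕ) + (k : ℕ)) := fun i k =>
    hper _ _ (by rw [Fin.val_add]; push_cast; simp)
  have triple : ∀ {t}, ¬ G.Adj v t → ∀ {i j k}, ¬ G.Adj (c i) (c j) → ¬ G.Adj (c i) (c k) →
      ¬ G.Adj (c j) (c k) → c i ≠ c j → G.Adj t (c k) → G.Adj t (c i) ∨ G.Adj t (c j) := by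
    intro t ht i j k hij hik hjk hne hk
    by_contra! hcon
    exact hf.elim (hvc i) (hvc j) (hvc k) hk.symm hne hij hik hjk ht (fun ha => hcon.1 ha.symm)
      (fun ha => hcon.2 ha.symm)
  have key : ∀ t, ¬ G.Adj v t → (∃ i, G.Adj t (c i)) →
      (∃ i : Fin 7, decide (G.Adj t (c (i : ℕ))) = true) ∧ ∀ i : Fin 7,
        (decide (G.Adj t (c (i : ℕ))) = true →
          decide (G.Adj t (c ((i + 2 : Fin 7) : ℕ))) = true ∨
            decide (G.Adj t (c ((i + 4 : Fin 7) : ℕ))) = true) ∧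
        (decide (G.Adj t (c ((i + 2 : Fin 7) : ℕ))) = true →
          decide (G.Adj t (c (i : ℕ))) = true ∨
            decide (G.Adj t (c ((i + 4 : Fin 7) : ℕ))) = true) ∧
        (decide (G.Adj t (c ((i + 4 : Fin 7) : ℕ))) = true →
          decide (G.Adj t (c (i : ℕ))) = true ∨
            decide (G.Adj t (c ((i + 2 : Fin 7) : ℕ))) = true) := by
    rintro t ht ⟨i, hi⟩
    simp only [decide_eq_true_eq]
    refine ⟨⟨⟨(i % 7).toNat, by omega⟩, ?_⟩, fun i => ?_⟩
    · rwa [hper ((i % 7).toNat : ℕ) i (by omega)]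
    · rw [hadd, hadd]
      have e1 : ((2 : Fin 7) : ℕ) = 2 := rfl
      have e2 : ((4 : Fin 7) : ℕ) = 4 := rfl
      rw [e1, e2]
      have n1 : ¬ G.Adj (c i) (c (i + 2)) := h.not_adj' (by omega) (by omega)
      have n2 : ¬ G.Adj (c i) (c (i + 4)) := h.not_adj' (by omega) (by omega)
      have n3 : ¬ G.Adj (c (i + 2)) (c (i + 4)) := h.not_adj' (by omega) (by omega)
      have d1 : c i ≠ c (i + 2) := h.ne (by omega) (by omega)
      have d2 : c i ≠ c (i + 4) := h.ne (by omega) (by omega)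
      have d3 : c (i + 2) ≠ c (i + 4) := h.ne (by omega) (by omega)
      exact ⟨triple ht n3 (fun h => n1 h.symm) (fun h => n2 h.symm) d3,
        triple ht n2 n1 (fun h => n3 h.symm) d2, triple ht n1 n2 n3 d1⟩
  obtain ⟨i, h1, h2, h3⟩ := exists_common_of_seven (a := fun i => decide (G.Adj x (c (i : ℕ))))
    (b := fun i => decide (G.Adj y (c (i : ℕ)))) (d := fun i => decide (G.Adj z (c (i : ℕ)))) (by
      rintro p (rfl | rfl | rfl)
      exacts [key x hx hxc, key y hy hyc, key z hz hzc])
  exact ⟨i, of_decide_eq_true h1, of_decide_eq_true h2, of_decide_eq_true h3⟩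

/-- The component splits when no vertex has four pairwise nonadjacent neighbours. -/
theorem hasSplit_of_no_independent [Finite V] (hf : ForkFree G) (hK4 : G.CliqueFree 4)
    {K : Set V} (habs : HolesAbsorb G K) (hconn : ∀ x ∈ K, ∀ y ∈ K, G.Reachable x y)
    (hclosed : ∀ x ∈ K, ∀ y, G.Adj x y → y ∈ K) {v : V} (hv : v ∈ K) (ht : ¬ Trisimplicial G v)
    (hind : ∀ T : Finset V, (∀ s ∈ T, G.Adj v s) → (∀ s ∈ T, ∀ t ∈ T, ¬ G.Adj s t) →
      T.card ≤ 3) : HasSplit G K := by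
  obtain ⟨n, c, h, hvc⟩ : ∃ n c, OddHole G n c ∧ ∀ i, G.Adj v (c i) := by
    by_contra! hcon
    refine ht (trisimplicial_of_bipartite (exists_bicoloring ?_ fun n c h hc => ?_) hind)
    · intro x hx y hy z hz hxy hyz hxz
      exact not_k4 hK4 hx hy hz hxy hxz hyz
    · obtain ⟨i, hi⟩ := hcon n c h
      exact hi (hc i)
  have hcK : ∀ i, c i ∈ K := fun i => hclosed v hv _ (hvc i)
  have hcov : ∀ y, G.Adj v y → ∃ i, y = c i := by
    intro y hy
    by_contra! hyc
    obtain ⟨i, hi⟩ := habs.exists_adj hconn h hcK (hclosed v hv y hy)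
    obtain ⟨j, hj, hj1⟩ := h.exists_consecutive hf hyc hi
    exact not_k4 hK4 hy (hvc _) (hvc _) hj hj1 (h.adj j)
  obtain rfl := h.length_eq_seven ht hvc hcov hind
  refine habs.hasSplit hconn hv {x | ¬ G.Adj v x} (fun x hx => hx) ?_ ?_
  · intro x hx y hy z hz hvx hvy hvz hxy hyz hxz
    obtain ⟨i, h1, h2, h3⟩ := h.exists_common_neighbor hf hvc hvx hvy hvz
      (habs.exists_adj hconn h hcK hx) (habs.exists_adj hconn h hcK hy)
      (habs.exists_adj hconn h hcK hz)
    exact not_k4 hK4 hxy hxz h1 hyz h2 h3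
  · intro x _ y _ z _ hx hy hz hxy hyz hxz
    simp only [Set.mem_ofPred_eq, not_not] at hx hy hz
    exact not_k4 hK4 hx hy hz hxy hxz hyz

theorem hasSplit_component [Finite V] (hf : ForkFree G) (hK4 : G.CliqueFree 4)
    (ht : ∀ u, ¬ Trisimplicial G u) (v₀ : V) : HasSplit G {x | G.Reachable v₀ x} := by
  have hconn : ∀ x ∈ {x | G.Reachable v₀ x}, ∀ y ∈ {x | G.Reachable v₀ x}, G.Reachable x y :=
    fun x hx y hy => hx.symm.trans hy
  have hclosed : ∀ x ∈ {x | G.Reachable v₀ x}, ∀ y, G.Adj x y → y ∈ {x | G.Reachable v₀ x} :=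
    fun x hx y hxy => hx.trans hxy.reachable
  by_cases habs : HolesAbsorb G {x | G.Reachable v₀ x}
  · obtain ⟨⟨v, S⟩, ⟨hv, hS, hind⟩, hmax⟩ := Set.exists_max_image
      {p : V × Finset V | G.Reachable v₀ p.1 ∧ (∀ s ∈ p.2, G.Adj p.1 s) ∧
        ∀ s ∈ p.2, ∀ t ∈ p.2, ¬ G.Adj s t} (fun p => p.2.card) (Set.toFinite _)
      ⟨(v₀, ∅), SimpleGraph.Reachable.refl _, by simp, by simp⟩
    by_cases hcard : 4 ≤ S.card
    · exact hasSplit_of_independent hf hK4 habs hconn hclosed hv hS hind hcard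
        fun u hu T hT hTi => hmax (u, T) ⟨hu, hT, hTi⟩
    · refine hasSplit_of_no_independent hf hK4 habs hconn hclosed hv (ht v) fun T hT hTi => ?_
      have : T.card ≤ S.card := hmax (v, T) ⟨hv, hT, hTi⟩
      omega
  · unfold HolesAbsorb at habs
    push Not at habs
    obtain ⟨n, c, h, hc, w, z, i₀, hwz, hw, hz⟩ := habs
    exact h.hasSplit_of_far hf hK4 ht hwz hz hw
      (hconn w (hclosed _ (hc i₀) w hw.symm))

theorem hasSplit_univ [Finite V] (hf : ForkFree G) (hK4 : G.CliqueFree 4)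
    (ht : ∀ u, ¬ Trisimplicial G u) : HasSplit G Set.univ := by
  choose f hf1 hf2 using hasSplit_component hf hK4 ht
  let r (x : V) : V := (G.connectedComponentMk x).out
  have hr : ∀ x, G.Reachable (r x) x := fun x => by
    rw [← SimpleGraph.ConnectedComponent.eq]
    exact Quot.out_eq _
  have hadj : ∀ {x y}, G.Adj x y → r x = r y := fun {x y} hxy =>
    congrArg Quot.out (SimpleGraph.ConnectedComponent.eq.2 hxy.reachable)
  refine ⟨fun x => f (r x) x, fun x _ y _ hxy he => ?_, fun x _ y _ z _ hxy hyz hxz hx hy hz => ?_⟩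
  · dsimp only at he ⊢
    rw [← hadj hxy] at he
    exact hf1 (r x) x (hr x) y (hadj hxy ▸ hr y) hxy he
  · dsimp only at hx hy hz
    rw [← hadj hxy] at hy
    rw [← hadj hxz] at hz
    exact hf2 (r x) x (hr x) y (hadj hxy ▸ hr y) z (hadj hxz ▸ hr z) hxy hyz hxz hx hy hz

theorem isPerfectGraph_of_colorable [Finite V] (hcol : G.Colorable 2) : IsPerfectGraph G := by
  classical
  intro S
  have := Fintype.ofFinite V
  have := Fintype.ofFinite S
  change _ = (((G.induce S).cliqueNum : ℕ) : ℕ∞)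
  refine le_antisymm ?_ SimpleGraph.cliqueNum_le_chromaticNumber
  by_cases hadj : ∃ a b, (G.induce S).Adj a b
  · obtain ⟨a, b, hab⟩ := hadj
    have h2 : 2 ≤ (G.induce S).cliqueNum := by
      have := SimpleGraph.IsClique.card_le_cliqueNum (G := G.induce S) (t := {a, b})
        (tc := by rw [Finset.coe_pair, SimpleGraph.isClique_pair]; exact fun _ => hab)
      rwa [Finset.card_pair hab.ne] at this
    have hS : (G.induce S).Colorable 2 :=
      hcol.of_hom (SimpleGraph.Embedding.induce S).toHom
    exact hS.chromaticNumber_le.trans (by exact_mod_cast h2)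
  · push Not at hadj
    rcases isEmpty_or_nonempty S with hS | ⟨⟨a⟩⟩
    · rw [SimpleGraph.chromaticNumber_eq_zero_of_isEmpty]
      exact zero_le
    · have h1 : 1 ≤ (G.induce S).cliqueNum := by
        have := SimpleGraph.IsClique.card_le_cliqueNum (G := G.induce S) (t := {a})
          (tc := by rw [Finset.coe_singleton]; exact SimpleGraph.isClique_singleton _)
        rwa [Finset.card_singleton] at this
      have hS : (G.induce S).Colorable 1 :=
        ⟨SimpleGraph.Coloring.mk (fun _ => 0) fun {x y} h => absurd h (hadj x y)⟩
      exact hS.chromaticNumber_le.trans (by exact_mod_cast h1)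

theorem cliqueNumber_le_of_cliqueFree [Finite V] {k : ℕ} (h : G.CliqueFree (k + 1)) :
    cliqueNumber G ≤ k := by
  have := Fintype.ofFinite V
  obtain ⟨s, hs⟩ := G.exists_isNClique_cliqueNum
  change G.cliqueNum ≤ k
  by_contra! hlt
  exact h.mono hlt s hs

theorem cliqueFree_of_cliqueNumber_lt [Finite V] {k : ℕ} (h : cliqueNumber G < k) :
    G.CliqueFree k := by
  have := Fintype.ofFinite V
  intro s hs
  have : s.card ≤ G.cliqueNum := hs.isClique.card_le_cliqueNum
  rw [hs.card_eq] at this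
  exact absurd (this.trans_lt h) (lt_irrefl _)

theorem cliqueFree_three_of_forall
    (h : ∀ x y z, G.Adj x y → G.Adj y z → G.Adj x z → False) : G.CliqueFree 3 := by
  classical
  intro s hs
  obtain ⟨a, b, c, hab, hac, hbc, -⟩ := SimpleGraph.is3Clique_iff.1 hs
  exact h a b c hab hbc hac

theorem not_k3 (h : G.CliqueFree 3) {x y z : V} (hxy : G.Adj x y)
    (hyz : G.Adj y z) (hxz : G.Adj x z) : False := by
  classical
  exact h {x, y, z} (SimpleGraph.is3Clique_triple_iff.2 ⟨hxy, hxz, hyz⟩)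

/-- A triangle-free fork-free graph is bipartite after deleting some independent set. -/
theorem exists_bipartite_compl_independent (hf : ForkFree G) (h3 : G.CliqueFree 3) :
    ∃ B : Set V, (∀ x ∈ B, ∀ y ∈ B, ¬ G.Adj x y) ∧ (G.induce Bᶜ).Colorable 2 := by
  let r (x : V) : V := (G.connectedComponentMk x).out
  have hr : ∀ x, G.Reachable x (r x) := fun x => by
    rw [← SimpleGraph.ConnectedComponent.eq]
    exact (Quot.out_eq _).symm
  have hadj : ∀ {x y}, G.Adj x y → r x = r y := fun {x y} hxy =>
    congrArg Quot.out (SimpleGraph.ConnectedComponent.eq.2 hxy.reachable)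
  refine ⟨{x | r x = x}, fun x hx y hy hxy => ?_, exists_bicoloring ?_ fun n c h hc => ?_⟩
  · have hxr : r x = x := hx
    have hyr : r y = y := hy
    exact hxy.ne (by rw [← hxr, ← hyr, hadj hxy])
  · exact fun x _ y _ z _ hxy hyz hxz => not_k3 h3 hxy hyz hxz
  · obtain ⟨i, hi⟩ := (hr (c 0)).induct (P := fun x => ∃ i, x = c i) (by
      rintro a b hab ⟨i, rfl⟩
      by_contra! hb
      obtain ⟨j, hj, hj1⟩ := h.exists_consecutive hf hb hab.symm
      exact not_k3 h3 (h.adj j) hj1.symm hj.symm) ⟨0, rfl⟩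
    refine hc i ?_
    change r (c i) = c i
    rw [← hi]
    exact congrArg Quot.out (Quot.out_eq _)

theorem exists_division_of_triangle [Finite V] (hsplit : HasSplit G Set.univ) {S : Set V}
    (h3 : ¬ (G.induce S).CliqueFree 3) : ∃ A B : Set V, A ∪ B = S ∧ A ∩ B = ∅ ∧
      IsPerfectGraph (G.induce A) ∧ cliqueNumber (G.induce B) < cliqueNumber (G.induce S) := by
  obtain ⟨f, hf, hf2⟩ := hsplit
  refine ⟨{x | x ∈ S ∧ f x ≠ 2}, {x | x ∈ S ∧ f x = 2}, ?_, ?_, ?_, ?_⟩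
  · ext x
    simp only [Set.mem_union, Set.mem_ofPred_eq]
    tauto
  · ext x
    simp only [Set.mem_inter_iff, Set.mem_ofPred_eq, Set.mem_empty_iff_false]
    tauto
  · apply isPerfectGraph_of_colorable
    have hlt : ∀ a : Fin 3, a ≠ 2 → (a : ℕ) < 2 := by decide
    refine ⟨SimpleGraph.Coloring.mk (fun x => ⟨f x, hlt _ x.2.2⟩) fun {x y} hxy he => ?_⟩
    exact x.2.2 (hf x trivial y trivial hxy (Fin.ext (by simpa using he)))
  · have hB := cliqueNumber_le_of_cliqueFree (G := G.induce {x | x ∈ S ∧ f x = 2}) (k := 2)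
      (cliqueFree_three_of_forall fun x y z hxy hyz hxz =>
        hf2 x trivial y trivial z trivial hxy hyz hxz x.2.2 y.2.2 z.2.2)
    by_contra hlt
    exact h3 (cliqueFree_of_cliqueNumber_lt (by omega))

theorem exists_division_of_cliqueFree_three [Finite V] (hf : ForkFree G) {S : Set V}
    (h3 : (G.induce S).CliqueFree 3) (h2 : ¬ (G.induce S).CliqueFree 2) :
    ∃ A B : Set V, A ∪ B = S ∧ A ∩ B = ∅ ∧
      IsPerfectGraph (G.induce A) ∧ cliqueNumber (G.induce B) < cliqueNumber (G.induce S) := by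
  obtain ⟨B, hB, ⟨C⟩⟩ := exists_bipartite_compl_independent (hf.induce S) h3
  refine ⟨Subtype.val '' Bᶜ, Subtype.val '' B, ?_, ?_, ?_, ?_⟩
  · rw [← Set.image_union, Set.compl_union_self, Set.image_univ, Subtype.range_coe]
  · rw [← Set.image_inter Subtype.val_injective, Set.compl_inter_self, Set.image_empty]
  · apply isPerfectGraph_of_colorable
    have hA : ∀ x : (Subtype.val '' Bᶜ : Set V), ∃ h : (x : V) ∈ S, (⟨x, h⟩ : S) ∈ Bᶜ := by
      rintro ⟨_, y, hy, rfl⟩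
      exact ⟨y.2, hy⟩
    choose hS hSB using hA
    exact ⟨SimpleGraph.Coloring.mk (fun x => C ⟨⟨x, hS x⟩, hSB x⟩) fun {x y} hxy => C.valid hxy⟩
  · have hle := cliqueNumber_le_of_cliqueFree (G := G.induce (Subtype.val '' B : Set V)) (k := 1)
      (SimpleGraph.cliqueFree_two.2 (by
        ext ⟨_, x, hx, rfl⟩ ⟨_, y, hy, rfl⟩
        simpa using hB x hx y hy))
    by_contra hlt
    exact h2 (cliqueFree_of_cliqueNumber_lt (by omega))

theorem exists_division_of_cliqueFree_two [Finite V] {S : Set V} (hS : S.Nonempty)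
    (h2 : (G.induce S).CliqueFree 2) :
    ∃ A B : Set V, A ∪ B = S ∧ A ∩ B = ∅ ∧
      IsPerfectGraph (G.induce A) ∧ cliqueNumber (G.induce B) < cliqueNumber (G.induce S) := by
  refine ⟨S, ∅, Set.union_empty S, Set.inter_empty S, ?_, ?_⟩
  · rw [SimpleGraph.cliqueFree_two.1 h2]
    exact isPerfectGraph_of_colorable
      ⟨SimpleGraph.Coloring.mk (fun _ => 0) fun {x y} hxy => absurd hxy (by simp)⟩
  · have hle := cliqueNumber_le_of_cliqueFree (G := G.induce (∅ : Set V)) (k := 0)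
      (SimpleGraph.cliqueFree_one.2 inferInstance)
    by_contra hlt
    have := SimpleGraph.cliqueFree_one.1
      (cliqueFree_of_cliqueNumber_lt (G := G.induce S) (k := 1) (by omega))
    exact this.false ⟨_, hS.some_mem⟩

end ForkFreeStructure

/-- A nonperfectly divisible fork-free graph with ω(G) ≤ 3 has a trisimplicial vertex. -/
theorem stmt_12 {V : Type*} [Fintype V] (G : SimpleGraph V)
    (hfork : ForkFree G) (hw : cliqueNumber G ≤ 3)
    (h : ¬ PerfectlyDivisible G) :
    ∃ u : V, Trisimplicial G u := by
  by_contra! ht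
  have hK4 : G.CliqueFree 4 := cliqueFree_of_cliqueNumber_lt (by omega)
  refine h fun S hS => ?_
  by_cases h3 : (G.induce S).CliqueFree 3
  · by_cases h2 : (G.induce S).CliqueFree 2
    · exact exists_division_of_cliqueFree_two hS h2
    · exact exists_division_of_cliqueFree_three hfork h3 h2
  · exact exists_division_of_triangle (hasSplit_univ hfork hK4 ht) h3
end
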